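/- arXiv:2001.08393 — 2 statements merged into one kernel-verified Lean document; each statement's English description precedes it below -/
import Mathlib

section
/- There exist positive constants δ*, C₁, C₂ such that the following holds. Let (ũ, v, θ̃, φ) be a solution of the reformulated PNPF system on [0, T], and assume ‖(ũ, v, θ̃)(t)‖_{H²} + ‖∇φ(t)‖_{L²} ≤ δ for all t ∈ [0, T] with δ ≤ δ*. Then for all t ∈ (0, T): (1/2)(d/dt)(‖(ũ, v)‖²_{L²} + 2c‖θ̃‖²_{L²}) + C₁‖∇(ũ, v, θ̃)‖²_{L²} + C₁‖v‖²_{L²} ≤ C₂ δ ‖∇φ‖²_{L²}. -/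
open MeasureTheory Filter Topology Real

noncomputable section

/-- Euclidean space ℝ³. -/
abbrev E3 : Type := EuclideanSpace ℝ (Fin 3)

/-- The `i`-th partial derivative `∂ᵢ f`. -/
def pd (i : Fin 3) (f : E3 → ℝ) (x : E3) : ℝ :=
  fderiv ℝ f x (EuclideanSpace.single i 1)

/-- The Laplacian `Δf`. -/
def lap (f : E3 → ℝ) (x : E3) : ℝ := ∑ i : Fin 3, pd i (pd i f) x

/-- The dot product of gradients `∇f · ∇g`. -/
def gdot (f g : E3 → ℝ) (x : E3) : ℝ := ∑ i : Fin 3, pd i f x * pd i g x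

/-- The squared `L²(ℝ³)` norm of the `k`-th total spatial derivative `‖∇ᵏf‖_{L²}²`. -/
def Dsq (k : ℕ) (f : E3 → ℝ) : ℝ := ∫ x : E3, ‖iteratedFDeriv ℝ k f x‖ ^ 2

/-- The squared `H²(ℝ³)` norm `‖f‖_{H²}²`. -/
def H2sq (f : E3 → ℝ) : ℝ := Dsq 0 f + Dsq 1 f + Dsq 2 f

/-- A solution of the reformulated PNPF system on the time interval `[0, T]`:
smooth, with `2 + ũ > 0`, `φ` the Newtonian potential of `v` (so `Δφ = v`,
`φ → 0` at infinity), all spatial derivatives of order `≤ 3` square integrable,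
decay at spatial infinity, and the three evolution equations. -/
def IsRefSol (c T : ℝ) (u v θ φ : ℝ → E3 → ℝ) : Prop :=
  -- smoothness
  ContDiffOn ℝ (⊤ : ℕ∞) (fun q : ℝ × E3 => u q.1 q.2) (Set.Icc 0 T ×ˢ Set.univ) ∧
  ContDiffOn ℝ (⊤ : ℕ∞) (fun q : ℝ × E3 => v q.1 q.2) (Set.Icc 0 T ×ˢ Set.univ) ∧
  ContDiffOn ℝ (⊤ : ℕ∞) (fun q : ℝ × E3 => θ q.1 q.2) (Set.Icc 0 T ×ˢ Set.univ) ∧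
  ContDiffOn ℝ (⊤ : ℕ∞) (fun q : ℝ × E3 => φ q.1 q.2) (Set.Icc 0 T ×ˢ Set.univ) ∧
  -- positivity of 2 + ũ
  (∀ t ∈ Set.Icc (0 : ℝ) T, ∀ x : E3, 0 < 2 + u t x) ∧
  -- φ is the Newtonian potential of v
  (∀ t ∈ Set.Icc (0 : ℝ) T, ∀ x : E3,
      φ t x = -(1 / (4 * π)) * ∫ y : E3, v t y / ‖x - y‖) ∧
  -- spatial derivatives of order ≤ 3 lie in L²
  (∀ t ∈ Set.Icc (0 : ℝ) T, ∀ k ≤ 3,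
      Integrable (fun x : E3 => ‖iteratedFDeriv ℝ k (u t) x‖ ^ 2) ∧
      Integrable (fun x : E3 => ‖iteratedFDeriv ℝ k (v t) x‖ ^ 2) ∧
      Integrable (fun x : E3 => ‖iteratedFDeriv ℝ k (θ t) x‖ ^ 2) ∧
      Integrable (fun x : E3 => ‖iteratedFDeriv ℝ (k + 1) (φ t) x‖ ^ 2)) ∧
  -- decay at spatial infinity
  (∀ t ∈ Set.Icc (0 : ℝ) T,
      Tendsto (u t) (cocompact E3) (nhds 0) ∧
      Tendsto (v t) (cocompact E3) (nhds 0) ∧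
      Tendsto (θ t) (cocompact E3) (nhds 0) ∧
      Tendsto (φ t) (cocompact E3) (nhds 0)) ∧
  -- equation (i)
  (∀ t ∈ Set.Icc (0 : ℝ) T, ∀ x : E3,
      deriv (fun s => u s x) t =
        lap (u t) x + 2 * lap (θ t) x + θ t x * lap (u t) x + u t x * lap (θ t) x
          + 2 * gdot (θ t) (u t) x - gdot (v t) (φ t) x - (v t x) ^ 2) ∧
  -- equation (ii)
  (∀ t ∈ Set.Icc (0 : ℝ) T, ∀ x : E3,
      deriv (fun s => v s x) t =
        lap (v t) x - 2 * v t x + θ t x * lap (v t) x + v t x * lap (θ t) x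
          + 2 * gdot (θ t) (v t) x - gdot (u t) (φ t) x - u t x * v t x) ∧
  -- equation (iii)
  (∀ t ∈ Set.Icc (0 : ℝ) T, ∀ x : E3,
      c * deriv (fun s => θ s x) t =
        (3 / 2) * lap (θ t) x + (1 / 2) * lap (u t) x + θ t x * lap (θ t) x
          - (u t x / (2 * (2 + u t x))) * lap (θ t) x
          + ((2 * (θ t x) ^ 2 + 4 * θ t x - u t x) / (2 * (2 + u t x))) * lap (u t) x
          + (c + 1) * gdot (θ t) (θ t) x
          + (c + 3) * ((1 + θ t x) / (2 + u t x)) * gdot (u t) (θ t) x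
          - 2 * ((1 + θ t x) / (2 + u t x)) * gdot (v t) (φ t) x
          - (c + 2) * (v t x / (2 + u t x)) * gdot (θ t) (φ t) x
          - ((1 + θ t x) / (2 + u t x)) * (v t x) ^ 2
          + gdot (φ t) (φ t) x)

lemma hasDerivAt_setIntegral_of_isCompact {K : Set E3} (hK : IsCompact K) {J : Set ℝ}
    (hJ : IsOpen J) {g g' : ℝ → E3 → ℝ} (hg : ∀ s ∈ J, Continuous (g s))
    (hg' : ContinuousOn (fun q : ℝ × E3 => g' q.1 q.2) (J ×ˢ Set.univ))
    (hd : ∀ s ∈ J, ∀ x, HasDerivAt (fun r => g r x) (g' s x) s) {t : ℝ} (ht : t ∈ J) :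
    HasDerivAt (fun s => ∫ x in K, g s x) (∫ x in K, g' t x) t := by
  obtain ⟨ε, hε, hεJ⟩ := Metric.nhds_basis_closedBall.mem_iff.1 (hJ.mem_nhds ht)
  have hc : IsCompact (Metric.closedBall t ε ×ˢ K) := (isCompact_closedBall t ε).prod hK
  obtain ⟨C, hC⟩ := hc.exists_bound_of_continuousOn
    (hg'.mono (Set.prod_mono hεJ (Set.subset_univ K)))
  have hg't : Continuous (g' t) := by
    rw [← continuousOn_univ]
    exact hg'.comp (f := fun x : E3 => (t, x)) (by fun_prop) (fun x _ => ⟨ht, trivial⟩)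
  refine (hasDerivAt_integral_of_dominated_loc_of_deriv_le (bound := fun _ => C)
    (Metric.closedBall_mem_nhds t hε) ?_ ?_ hg't.aestronglyMeasurable ?_ ?_ ?_).2
  · filter_upwards [hJ.mem_nhds ht] with s hs using (hg s hs).aestronglyMeasurable
  · exact (hg t ht).continuousOn.integrableOn_compact hK
  · filter_upwards [ae_restrict_mem hK.measurableSet] with x hx s hs using hC (s, x) ⟨hs, hx⟩
  · exact integrableOn_const hK.measure_lt_top.ne
  · exact Eventually.of_forall fun x s hs => hd s (hεJ hs) x

lemma sq_integral_mul_le {μ : Measure E3} {f g : E3 → ℝ} (hf : Integrable (fun x => f x ^ 2) μ)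
    (hg : Integrable (fun x => g x ^ 2) μ) (hfg : Integrable (fun x => f x * g x) μ) :
    (∫ x, f x * g x ∂μ) ^ 2 ≤ (∫ x, f x ^ 2 ∂μ) * ∫ x, g x ^ 2 ∂μ := by
  have key : ∀ a : ℝ, 0 ≤ (∫ x, g x ^ 2 ∂μ) * (a * a) + (-2 * ∫ x, f x * g x ∂μ) * a
      + ∫ x, f x ^ 2 ∂μ := by
    intro a
    have h0 : 0 ≤ ∫ x, (f x - a * g x) ^ 2 ∂μ := integral_nonneg fun x => sq_nonneg _
    have : ∀ x, (f x - a * g x) ^ 2 = f x ^ 2 - 2 * a * (f x * g x) + a ^ 2 * g x ^ 2 :=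
      fun x => by ring
    simp_rw [this] at h0
    rw [integral_add (f := fun x => f x ^ 2 - 2 * a * (f x * g x))
      (Integrable.sub hf (hfg.const_mul _)) (hg.const_mul _), integral_sub hf (hfg.const_mul _),
      integral_const_mul, integral_const_mul] at h0
    linarith
  have := discrim_le_zero key
  rw [discrim] at this
  linarith

lemma sq_setIntegral_le {K : Set E3} (hK : IsCompact K) {g : E3 → ℝ} (hg : Continuous g) :
    (∫ x in K, g x) ^ 2 ≤ volume.real K * ∫ x in K, g x ^ 2 := by
  have := sq_integral_mul_le (μ := volume.restrict K) (f := fun _ => 1) (g := g)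
    (by simpa [IntegrableOn] using! integrableOn_const (C := (1 : ℝ)) hK.measure_lt_top.ne)
    ((hg.pow 2).continuousOn.integrableOn_compact hK)
    (by simpa [IntegrableOn] using! hg.continuousOn.integrableOn_compact (μ := volume) hK)
  simpa using this

lemma integrable_comp_add_smul {g : E3 → ℝ} (hg : Integrable g) (x : E3) {l : ℝ} (hl : 0 < l) :
    Integrable fun z => g (x + l • z) :=
  (hg.comp_add_left x).comp_smul hl.ne'

lemma integral_comp_add_smul (g : E3 → ℝ) (x : E3) {l : ℝ} (hl : 0 < l) :
    ∫ z, g (x + l • z) = (l ^ 3)⁻¹ * ∫ z, g z := by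
  have := Measure.integral_comp_smul (volume : Measure E3) (fun y => g (x + y)) l
  rw [this, integral_add_left_eq_self g x]
  simp [abs_of_pos hl]

lemma abs_setIntegral_comp_add_smul_le {K : Set E3} (hK : IsCompact K) {g h : E3 → ℝ}
    (hg : Continuous g) (hh : Integrable fun x => h x ^ 2) (hgh : ∀ x, |g x| ≤ h x)
    (x : E3) {l : ℝ} (hl : 0 < l) :
    |∫ z in K, g (x + (l ^ 2) • z)|
      ≤ √(volume.real K) * (√(∫ z, h z ^ 2) / l ^ 3) := by
  have hl2 : 0 < l ^ 2 := by positivity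
  have hgc : Continuous fun z => g (x + (l ^ 2) • z) := by fun_prop
  have hle : ∫ z in K, g (x + (l ^ 2) • z) ^ 2 ≤ ((l ^ 2) ^ 3)⁻¹ * ∫ z, h z ^ 2 := by
    rw [← integral_comp_add_smul (fun z => h z ^ 2) x hl2]
    have hi := integrable_comp_add_smul hh x hl2
    refine (integral_mono_of_nonneg (Eventually.of_forall fun z => sq_nonneg _) hi.integrableOn
      (Eventually.of_forall fun z => ?_)).trans
      (setIntegral_le_integral hi (Eventually.of_forall fun z => sq_nonneg _))
    exact sq_le_sq.2 ((hgh _).trans (le_abs_self _))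
  refine abs_le_of_sq_le_sq ?_ (by positivity)
  rw [mul_pow, div_pow, Real.sq_sqrt measureReal_nonneg,
    Real.sq_sqrt (integral_nonneg fun z => sq_nonneg _)]
  refine (sq_setIntegral_le hK hgc).trans ?_
  refine mul_le_mul_of_nonneg_left (hle.trans_eq ?_) measureReal_nonneg
  rw [← pow_mul, ← pow_mul]; field_simp

/-- A scaled form of the embedding `H² ⊂ L^∞` on `ℝ³`. -/
lemma exists_abs_le_of_H2 : ∃ K > (0 : ℝ), ∀ f : E3 → ℝ, ContDiff ℝ 2 f →
    (∀ k ≤ 2, Integrable fun x => ‖iteratedFDeriv ℝ k f x‖ ^ 2) → ∀ m > (0 : ℝ), ∀ x,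
    |f x| ≤ K * (√(Dsq 0 f) / m ^ 3 + √(Dsq 1 f) / m + m * √(Dsq 2 f)) := by
  set B : Set E3 := Metric.closedBall 0 1
  have hB : IsCompact B := isCompact_closedBall 0 1
  have hV : 0 < volume.real B := by
    exact ENNReal.toReal_pos (Metric.measure_closedBall_pos _ _ one_pos).ne'
      hB.measure_lt_top.ne
  refine ⟨2 * √(volume.real B) / volume.real B, by positivity, fun f hf hi m hm x => ?_⟩
  have hf1 : ContDiff ℝ 1 (fderiv ℝ f) := hf.fderiv_right (by norm_num)
  have hf2 : Continuous (fderiv ℝ (fderiv ℝ f)) := hf1.continuous_fderiv (by norm_num)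
  have hf0 := hf.continuous
  have hf1c := hf1.continuous
  have hn1 : ∀ y, ‖fderiv ℝ f y‖ = ‖iteratedFDeriv ℝ 1 f y‖ := fun y =>
    norm_iteratedFDeriv_one f |>.symm
  have hn2 : ∀ y, ‖fderiv ℝ (fderiv ℝ f) y‖ = ‖iteratedFDeriv ℝ 2 f y‖ := fun y => by
    rw [← norm_iteratedFDeriv_fderiv, norm_iteratedFDeriv_one]
  have hf2n : Continuous fun y => ‖fderiv ℝ (fderiv ℝ f) y‖ := by
    simp_rw [hn2]
    exact (hf.continuous_iteratedFDeriv (m := 2) le_rfl).norm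
  set N : ℝ → E3 → ℝ := fun l z => f (x + l ^ 2 • z) - l ^ 2 * fderiv ℝ f (x + l ^ 2 • z) z
  set N' : ℝ → E3 → ℝ := fun l z =>
    -(2 * l ^ 3) * fderiv ℝ (fderiv ℝ f) (x + l ^ 2 • z) z z
  have hd : ∀ l z, HasDerivAt (fun r => N r z) (N' l z) l := by
    intro l z
    have hp : HasDerivAt (fun r : ℝ => x + r ^ 2 • z) ((2 * l) • z) l := by
      simpa using ((hasDerivAt_pow 2 l).smul_const z).const_add x
    have h1 := ((hf.differentiable (by norm_num)) (x + l ^ 2 • z)).hasFDerivAt.comp_hasDerivAt l hp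
    have h2 := ((hf1.differentiable (by norm_num)) (x + l ^ 2 • z)).hasFDerivAt.comp_hasDerivAt
      l hp
    have h3 := (hasDerivAt_pow 2 l).mul (h2.clm_apply (hasDerivAt_const l z))
    have h4 := h1.sub h3
    refine h4.congr_deriv ?_
    simp [N']
    ring
  have hder : ∀ l, HasDerivAt (fun r => ∫ z in B, N r z) (∫ z in B, N' l z) l := by
    intro l
    refine hasDerivAt_setIntegral_of_isCompact hB isOpen_univ (fun s _ => ?_) ?_
      (fun s _ z => hd s z) (Set.mem_univ l)
    · fun_prop
    · apply Continuous.continuousOn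
      fun_prop
  have hi' : ∀ g : E3 → ℝ, Continuous g → IntegrableOn g B := fun g hg =>
    hg.continuousOn.integrableOn_compact hB
  have hav : ∀ k ≤ 2, ∀ l > (0 : ℝ), ∀ g : E3 → ℝ, Continuous g →
      (∀ y, g y = ‖iteratedFDeriv ℝ k f y‖) →
      ∫ z in B, g (x + l ^ 2 • z) ≤ √(volume.real B) * (√(Dsq k f) / l ^ 3) := by
    intro k hk l hl g hg hgk
    refine (le_abs_self _).trans (abs_setIntegral_comp_add_smul_le hB hg (hi k hk) ?_ x hl)
    intro y
    rw [hgk y, abs_norm]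
  have hzB : ∀ z ∈ B, ‖z‖ ≤ 1 := fun z hz => by simpa [B] using hz
  have hN' : ∀ l ∈ Set.Icc 0 m, ‖∫ z in B, N' l z‖ ≤ 2 * (√(volume.real B) * √(Dsq 2 f)) := by
    intro l hl
    rcases hl.1.eq_or_lt with h | h
    · subst h
      simp only [N']
      simp
      positivity
    · have h1 : ‖∫ z in B, N' l z‖ ≤
          ∫ z in B, 2 * l ^ 3 * ‖fderiv ℝ (fderiv ℝ f) (x + l ^ 2 • z)‖ := by
        refine norm_integral_le_of_norm_le
          (hi' _ (continuous_const.mul (hf2n.comp (g := fun y => ‖fderiv ℝ (fderiv ℝ f) y‖)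
            (by fun_prop)))) ?_
        filter_upwards [ae_restrict_mem hB.measurableSet] with z hz
        simp only [N', norm_mul, norm_neg]
        rw [Real.norm_of_nonneg (by positivity : 0 ≤ l ^ 3), Real.norm_two]
        gcongr
        refine (ContinuousLinearMap.le_opNorm₂ _ z z).trans ?_
        have := hzB z hz
        calc _ ≤ ‖fderiv ℝ (fderiv ℝ f) (x + l ^ 2 • z)‖ * 1 * 1 := by gcongr
          _ = _ := by ring
      refine h1.trans ?_
      rw [integral_const_mul]
      have h2 := hav 2 le_rfl l h (fun y => ‖fderiv ℝ (fderiv ℝ f) y‖) hf2n hn2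
      calc _ ≤ 2 * l ^ 3 * (√(volume.real B) * (√(Dsq 2 f) / l ^ 3)) := by gcongr
        _ = _ := by field_simp
  have hmv := (convex_Icc 0 m).norm_image_sub_le_of_norm_hasDerivWithin_le
    (fun l _ => (hder l).hasDerivWithinAt) hN' (Set.left_mem_Icc.2 hm.le)
    (Set.right_mem_Icc.2 hm.le)
  have hN0 : ∫ z in B, N 0 z = volume.real B * f x := by
    simp [N]
  have hNm : ‖∫ z in B, N m z‖ ≤ √(volume.real B) * (√(Dsq 0 f) / m ^ 3)
      + m ^ 2 * (√(volume.real B) * (√(Dsq 1 f) / m ^ 3)) := by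
    have h1 : ‖∫ z in B, N m z‖ ≤
        ∫ z in B, (|f (x + m ^ 2 • z)| + m ^ 2 * ‖fderiv ℝ f (x + m ^ 2 • z)‖) := by
      refine norm_integral_le_of_norm_le (hi' _ (by fun_prop)) ?_
      filter_upwards [ae_restrict_mem hB.measurableSet] with z hz
      refine (norm_sub_le _ _).trans ?_
      rw [Real.norm_eq_abs, norm_mul, Real.norm_of_nonneg (by positivity : 0 ≤ m ^ 2)]
      gcongr
      refine (ContinuousLinearMap.le_opNorm _ z).trans ?_
      exact mul_le_of_le_one_right (norm_nonneg _) (hzB z hz)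
    rw [integral_add (hi' _ (by fun_prop)) (hi' _ (by fun_prop)), integral_const_mul] at h1
    have h2 := hav 0 (by norm_num) m hm (fun y => |f y|) (by fun_prop)
      (fun y => by rw [norm_iteratedFDeriv_zero, Real.norm_eq_abs])
    have h3 := hav 1 (by norm_num) m hm (fun y => ‖fderiv ℝ f y‖) (by fun_prop) hn1
    refine h1.trans ?_
    gcongr
  rw [hN0, sub_zero, Real.norm_of_nonneg hm.le] at hmv
  have hfin : volume.real B * |f x| ≤ √(volume.real B) * (√(Dsq 0 f) / m ^ 3)
      + m ^ 2 * (√(volume.real B) * (√(Dsq 1 f) / m ^ 3))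
      + 2 * (√(volume.real B) * √(Dsq 2 f)) * m := by
    have h1 : volume.real B * |f x| = ‖volume.real B * f x‖ := by
      rw [norm_mul, Real.norm_of_nonneg hV.le, Real.norm_eq_abs]
    rw [h1]
    have := norm_sub_norm_le (volume.real B * f x) (∫ z in B, N m z)
    rw [norm_sub_rev] at this
    linarith
  rw [div_mul_eq_mul_div, le_div_iff₀ hV, mul_comm]
  refine hfin.trans ?_
  have e : m ^ 2 * (√(volume.real B) * (√(Dsq 1 f) / m ^ 3))
      = √(volume.real B) * (√(Dsq 1 f) / m) := by field_simp
  rw [e]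
  have p0 : 0 ≤ √(volume.real B) * (√(Dsq 0 f) / m ^ 3) := by positivity
  have p1 : 0 ≤ √(volume.real B) * (√(Dsq 1 f) / m) := by positivity
  nlinarith

lemma integrable_of_abs_le {f g : E3 → ℝ} (hf : Continuous f) (hg : Integrable g)
    (h : ∀ x, |f x| ≤ g x) : Integrable f :=
  hg.mono' hf.aestronglyMeasurable (Eventually.of_forall h)

lemma integrable_mul_of_sq {f g : E3 → ℝ} (hf : Continuous f) (hg : Continuous g)
    (hf2 : Integrable fun x => f x ^ 2) (hg2 : Integrable fun x => g x ^ 2) :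
    Integrable fun x => f x * g x := by
  refine integrable_of_abs_le (hf.mul hg) (hf2.add hg2) fun x => ?_
  simp only [Pi.add_apply]
  rw [abs_le]
  constructor <;> nlinarith [sq_nonneg (f x + g x), sq_nonneg (f x - g x), sq_nonneg (f x),
    sq_nonneg (g x)]

lemma gdot_self (f : E3 → ℝ) (x : E3) : gdot f f x = ‖fderiv ℝ f x‖ ^ 2 := by
  rw [← (InnerProductSpace.toDual ℝ E3).symm.norm_map (fderiv ℝ f x),
    ← (EuclideanSpace.basisFun (Fin 3) ℝ).sum_sq_norm_inner_right]
  simp only [gdot, pd, EuclideanSpace.basisFun_apply]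
  refine Finset.sum_congr rfl fun i _ => ?_
  rw [real_inner_comm, InnerProductSpace.toDual_symm_apply, Real.norm_eq_abs, sq_abs, sq]

lemma gdot_self_nonneg (f : E3 → ℝ) (x : E3) : 0 ≤ gdot f f x := by
  rw [gdot_self]; positivity

lemma gdot_comm (f g : E3 → ℝ) (x : E3) : gdot f g x = gdot g f x := by
  simp only [gdot, mul_comm]

lemma abs_gdot_le (f g : E3 → ℝ) (x : E3) : |gdot f g x| ≤ (gdot f f x + gdot g g x) / 2 := by
  simp only [gdot, Fin.sum_univ_three]
  rw [abs_le]
  constructor <;>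
  nlinarith [sq_nonneg (pd 0 f x + pd 0 g x), sq_nonneg (pd 1 f x + pd 1 g x),
    sq_nonneg (pd 2 f x + pd 2 g x), sq_nonneg (pd 0 f x - pd 0 g x),
    sq_nonneg (pd 1 f x - pd 1 g x), sq_nonneg (pd 2 f x - pd 2 g x)]

lemma Dsq_zero_eq (f : E3 → ℝ) : Dsq 0 f = ∫ x, f x ^ 2 := by
  simp [Dsq, norm_iteratedFDeriv_zero]

lemma norm_iteratedFDeriv_one_sq (f : E3 → ℝ) (x : E3) :
    ‖iteratedFDeriv ℝ 1 f x‖ ^ 2 = gdot f f x := by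
  rw [gdot_self, norm_iteratedFDeriv_one]

lemma Dsq_one_eq (f : E3 → ℝ) : Dsq 1 f = ∫ x, gdot f f x := by
  simp only [Dsq, norm_iteratedFDeriv_one_sq]

lemma Dsq_nonneg (k : ℕ) (f : E3 → ℝ) : 0 ≤ Dsq k f := integral_nonneg fun x => by positivity

lemma contDiff_pd {f : E3 → ℝ} {n : ℕ} (hf : ContDiff ℝ (n + 1) f) (i : Fin 3) :
    ContDiff ℝ n (pd i f) :=
  (hf.fderiv_right le_rfl).clm_apply contDiff_const

lemma continuous_pd {f : E3 → ℝ} (hf : ContDiff ℝ 1 f) (i : Fin 3) : Continuous (pd i f) :=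
  (contDiff_pd (n := 0) (by simpa using hf) i).continuous

lemma contDiff_one_pd {f : E3 → ℝ} (hf : ContDiff ℝ 2 f) (i : Fin 3) : ContDiff ℝ 1 (pd i f) :=
  contDiff_pd (n := 1) (hf.of_le (by norm_num)) i

lemma continuous_gdot {f g : E3 → ℝ} (hf : ContDiff ℝ 1 f) (hg : ContDiff ℝ 1 g) :
    Continuous (gdot f g) :=
  continuous_finsetSum _ fun i _ => (continuous_pd hf i).mul (continuous_pd hg i)

lemma continuous_lap {f : E3 → ℝ} (hf : ContDiff ℝ 2 f) : Continuous (lap f) :=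
  continuous_finsetSum _ fun i _ => continuous_pd (contDiff_one_pd hf i) i

lemma abs_pd_pd_le {f : E3 → ℝ} (hf : ContDiff ℝ 2 f) (i : Fin 3) (x : E3) :
    |pd i (pd i f) x| ≤ ‖iteratedFDeriv ℝ 2 f x‖ := by
  have hf1 : ContDiff ℝ 1 (fderiv ℝ f) := hf.fderiv_right (by norm_num)
  have h : pd i (pd i f) x = fderiv ℝ (fderiv ℝ f) x (EuclideanSpace.single i 1)
      (EuclideanSpace.single i 1) := by
    have := ((hf1.differentiable (by norm_num)) x).hasFDerivAt.clm_apply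
      (hasFDerivAt_const (EuclideanSpace.single i (1 : ℝ)) x)
    change fderiv ℝ (fun y => fderiv ℝ f y (EuclideanSpace.single i 1)) x _ = _
    rw [this.fderiv]
    simp
  rw [h, ← norm_iteratedFDeriv_fderiv, norm_iteratedFDeriv_one, ← Real.norm_eq_abs]
  refine (ContinuousLinearMap.le_opNorm₂ _ _ _).trans ?_
  simp

lemma sq_lap_le {f : E3 → ℝ} (hf : ContDiff ℝ 2 f) (x : E3) :
    lap f x ^ 2 ≤ 9 * ‖iteratedFDeriv ℝ 2 f x‖ ^ 2 := by
  have h : |lap f x| ≤ 3 * ‖iteratedFDeriv ℝ 2 f x‖ := by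
    refine (Finset.abs_sum_le_sum_abs _ _).trans ?_
    refine (Finset.sum_le_sum fun i _ => abs_pd_pd_le hf i x).trans ?_
    simp
  calc lap f x ^ 2 = |lap f x| ^ 2 := (sq_abs _).symm
    _ ≤ (3 * ‖iteratedFDeriv ℝ 2 f x‖) ^ 2 := by gcongr
    _ = _ := by ring

lemma sq_pd_le (f : E3 → ℝ) (i : Fin 3) (x : E3) : pd i f x ^ 2 ≤ gdot f f x := by
  rw [gdot, sq]
  exact Finset.single_le_sum (f := fun j => pd j f x * pd j f x)
    (fun j _ => mul_self_nonneg _) (Finset.mem_univ i)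

lemma integrable_sq_pd {f : E3 → ℝ} (hf : ContDiff ℝ 1 f) (h : Integrable (gdot f f))
    (i : Fin 3) : Integrable fun x => pd i f x ^ 2 :=
  integrable_of_abs_le ((continuous_pd hf i).pow 2) h fun x => by
    rw [abs_of_nonneg (sq_nonneg _)]; exact sq_pd_le f i x

lemma integrable_sq_lap {f : E3 → ℝ} (hf : ContDiff ℝ 2 f)
    (h : Integrable fun x => ‖iteratedFDeriv ℝ 2 f x‖ ^ 2) : Integrable fun x => lap f x ^ 2 :=
  integrable_of_abs_le ((continuous_lap hf).pow 2) (h.const_mul 9) fun x => by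
    rw [abs_of_nonneg (sq_nonneg _)]; exact sq_lap_le hf x

/-- Green's first identity on `ℝ³`. -/
lemma integral_mul_lap_add_gdot {F g : E3 → ℝ} (hF : ContDiff ℝ 1 F) (hg : ContDiff ℝ 2 g)
    (hF0 : Integrable fun x => F x ^ 2) (hF1 : Integrable (gdot F F))
    (hg1 : Integrable (gdot g g)) (hg2 : Integrable fun x => ‖iteratedFDeriv ℝ 2 g x‖ ^ 2) :
    Integrable (fun x => F x * lap g x + gdot F g x) ∧
      ∫ x, (F x * lap g x + gdot F g x) = 0 := by
  have hg' : ContDiff ℝ 1 g := hg.of_le (by norm_num)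
  have hFc := hF.continuous
  have i1 : ∀ i, Integrable fun x => F x * pd i (pd i g) x := fun i => by
    have hc := continuous_pd (contDiff_one_pd hg i) i
    refine integrable_mul_of_sq hFc hc hF0 (integrable_of_abs_le (hc.pow 2) hg2 fun x => ?_)
    rw [abs_of_nonneg (sq_nonneg _), ← sq_abs]
    gcongr
    exact abs_pd_pd_le hg i x
  have i2 : ∀ i, Integrable fun x => pd i F x * pd i g x := fun i =>
    integrable_mul_of_sq (continuous_pd hF i) (continuous_pd hg' i)
      (integrable_sq_pd hF hF1 i) (integrable_sq_pd hg' hg1 i)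
  have i3 : ∀ i, Integrable fun x => F x * pd i g x := fun i =>
    integrable_mul_of_sq hFc (continuous_pd hg' i) hF0 (integrable_sq_pd hg' hg1 i)
  have e : (fun x => F x * lap g x + gdot F g x)
      = fun x => ∑ i : Fin 3, (F x * pd i (pd i g) x + pd i F x * pd i g x) := by
    funext x
    simp only [lap, gdot, Finset.mul_sum, Finset.sum_add_distrib]
  rw [e]
  have i4 : ∀ i ∈ Finset.univ,
      Integrable fun x => F x * pd i (pd i g) x + pd i F x * pd i g x := fun i _ =>
    (i1 i).add (i2 i)
  refine ⟨integrable_finsetSum _ i4, ?_⟩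
  rw [integral_finsetSum _ i4]
  refine Finset.sum_eq_zero fun i _ => ?_
  have := integral_mul_fderiv_eq_neg_fderiv_mul_of_integrable (μ := volume) (f := F)
    (g := pd i g) (v := EuclideanSpace.single i (1 : ℝ)) (i2 i) (i1 i) (i3 i)
    (fun x _ => hF.differentiable (by norm_num) x)
    (fun x _ => (contDiff_one_pd hg i).differentiable (by norm_num) x)
  rw [integral_add (i1 i) (i2 i)]
  change ∫ x, F x * pd i (pd i g) x = - ∫ x, pd i F x * pd i g x at this
  rw [this]; ring

lemma sq_Dsq_one_le {f : E3 → ℝ} (hf : ContDiff ℝ 2 f)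
    (hi : ∀ k ≤ 2, Integrable fun x => ‖iteratedFDeriv ℝ k f x‖ ^ 2) :
    Dsq 1 f ^ 2 ≤ 9 * (Dsq 0 f * Dsq 2 f) := by
  have h0 : Integrable fun x => f x ^ 2 := by
    simpa [norm_iteratedFDeriv_zero] using hi 0 (by norm_num)
  have h1 : Integrable (gdot f f) := by
    simpa only [norm_iteratedFDeriv_one_sq] using hi 1 (by norm_num)
  have h2 := hi 2 le_rfl
  have hf' : ContDiff ℝ 1 f := hf.of_le (by norm_num)
  have hl := integrable_sq_lap hf h2
  have hm := integrable_mul_of_sq hf.continuous (continuous_lap hf) h0 hl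
  have := (integral_mul_lap_add_gdot hf' hf h0 h1 h1 h2).2
  rw [integral_add hm h1] at this
  have e : Dsq 1 f = -∫ x, f x * lap f x := by rw [Dsq_one_eq]; linarith
  rw [e, neg_sq]
  refine (sq_integral_mul_le h0 hl hm).trans ?_
  have h3 : ∫ x, lap f x ^ 2 ≤ 9 * Dsq 2 f := by
    rw [Dsq, ← integral_const_mul]
    exact integral_mono hl (h2.const_mul 9) (sq_lap_le hf)
  rw [← Dsq_zero_eq]
  nlinarith [Dsq_nonneg 0 f]

lemma integrable_sq_norm_iteratedFDeriv_sub {f g : E3 → ℝ} (hf : ContDiff ℝ 2 f)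
    (hg : ContDiff ℝ 2 g) {k : ℕ} (hk : k ≤ 2)
    (hfi : Integrable fun x => ‖iteratedFDeriv ℝ k f x‖ ^ 2)
    (hgi : Integrable fun x => ‖iteratedFDeriv ℝ k g x‖ ^ 2) :
    Integrable (fun x => ‖iteratedFDeriv ℝ k (fun y => f y - g y) x‖ ^ 2) ∧
      Dsq k (fun y => f y - g y) ≤ 2 * (Dsq k f + Dsq k g) := by
  have hk' : ((k : ℕ) : WithTop ℕ∞) ≤ 2 := by exact_mod_cast hk
  have hle : ∀ x, ‖iteratedFDeriv ℝ k (fun y => f y - g y) x‖ ^ 2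
      ≤ 2 * (‖iteratedFDeriv ℝ k f x‖ ^ 2 + ‖iteratedFDeriv ℝ k g x‖ ^ 2) := by
    intro x
    have e : iteratedFDeriv ℝ k (fun y => f y - g y) x
        = iteratedFDeriv ℝ k f x - iteratedFDeriv ℝ k g x :=
      iteratedFDeriv_sub_apply (hf.of_le hk').contDiffAt (hg.of_le hk').contDiffAt
    rw [e]
    have h := norm_sub_le (iteratedFDeriv ℝ k f x) (iteratedFDeriv ℝ k g x)
    have h0 := norm_nonneg (iteratedFDeriv ℝ k f x - iteratedFDeriv ℝ k g x)
    nlinarith [sq_nonneg (‖iteratedFDeriv ℝ k f x‖ - ‖iteratedFDeriv ℝ k g x‖)]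
  have hi2 := (hfi.add hgi).const_mul 2
  have hi : Integrable (fun x => ‖iteratedFDeriv ℝ k (fun y => f y - g y) x‖ ^ 2) := by
    refine integrable_of_abs_le ?_ hi2 fun x => ?_
    · exact (((hf.sub hg).of_le hk').continuous_iteratedFDeriv le_rfl).norm.pow 2
    · rw [abs_of_nonneg (sq_nonneg _)]
      exact hle x
  refine ⟨hi, ?_⟩
  simp only [Dsq]
  rw [← integral_add hfi hgi, ← integral_const_mul]
  exact integral_mono hi hi2 hle

lemma eventually_abs_sub_le_of_tendsto_Dsq_zero {w : ℝ → E3 → ℝ} {J : Set ℝ} {t M : ℝ}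
    (hJ : J ∈ 𝓝 t) (hw : ∀ s ∈ J, ContDiff ℝ 2 (w s))
    (hi : ∀ s ∈ J, ∀ k ≤ 2, Integrable fun x => ‖iteratedFDeriv ℝ k (w s) x‖ ^ 2)
    (hD2 : ∀ s ∈ J, Dsq 2 (w s) ≤ M)
    (h0 : Tendsto (fun s => Dsq 0 (fun x => w s x - w t x)) (𝓝 t) (𝓝 0)) {ε : ℝ} (hε : 0 < ε) :
    ∀ᶠ s in 𝓝 t, ∀ x, |w s x - w t x| ≤ ε := by
  obtain ⟨K, hK, hsup⟩ := exists_abs_le_of_H2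
  have htJ := mem_of_mem_nhds hJ
  set d : ℝ → E3 → ℝ := fun s x => w s x - w t x
  have hdi : ∀ s ∈ J, ∀ k ≤ 2, Integrable (fun x => ‖iteratedFDeriv ℝ k (d s) x‖ ^ 2) ∧
      Dsq k (d s) ≤ 2 * (Dsq k (w s) + Dsq k (w t)) := fun s hs k hk =>
    integrable_sq_norm_iteratedFDeriv_sub (hw s hs) (hw t htJ) hk (hi s hs k hk) (hi t htJ k hk)
  have hd2 : ∀ s ∈ J, Dsq 2 (d s) ≤ 4 * M := fun s hs => by
    linarith [(hdi s hs 2 le_rfl).2, hD2 s hs, hD2 t htJ]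
  have hdc : ∀ s ∈ J, ContDiff ℝ 2 (d s) := fun s hs => (hw s hs).sub (hw t htJ)
  have hd1 : ∀ s ∈ J, Dsq 1 (d s) ≤ √(9 * (Dsq 0 (d s) * (4 * M))) := fun s hs => by
    refine Real.le_sqrt_of_sq_le ((sq_Dsq_one_le (hdc s hs) fun k hk => (hdi s hs k hk).1).trans ?_)
    have := Dsq_nonneg 0 (d s)
    gcongr
    exact hd2 s hs
  obtain ⟨m, hm, hmε⟩ : ∃ m > 0, K * (m * √(4 * M)) < ε / 2 := by
    refine ⟨ε / (4 * K * (√(4 * M) + 1)), by positivity, ?_⟩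
    have h1 : √(4 * M) / (√(4 * M) + 1) ≤ 1 := by
      rw [div_le_one (by positivity)]; linarith
    calc _ = ε / 4 * (√(4 * M) / (√(4 * M) + 1)) := by field_simp
      _ ≤ ε / 4 * 1 := by gcongr
      _ < ε / 2 := by linarith
  have hlim : Tendsto (fun s => K * (√(Dsq 0 (d s)) / m ^ 3
      + √(√(9 * (Dsq 0 (d s) * (4 * M)))) / m)) (𝓝 t) (𝓝 0) := by
    have hc : Continuous fun y : ℝ => K * (√y / m ^ 3 + √(√(9 * (y * (4 * M)))) / m) := by
      fun_prop
    have h := (hc.tendsto 0).comp h0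
    rwa [show K * (√(0 : ℝ) / m ^ 3 + √(√(9 * (0 * (4 * M)))) / m) = 0 by simp] at h
  filter_upwards [hJ, hlim.eventually_lt_const (half_pos hε)] with s hs hlt x
  refine (hsup (d s) (hdc s hs) (fun k hk => (hdi s hs k hk).1) m hm x).trans ?_
  have h1 := Real.sqrt_le_sqrt (hd1 s hs)
  have h2 := Real.sqrt_le_sqrt (hd2 s hs)
  calc K * (√(Dsq 0 (d s)) / m ^ 3 + √(Dsq 1 (d s)) / m + m * √(Dsq 2 (d s)))
      ≤ K * (√(Dsq 0 (d s)) / m ^ 3 + √(√(9 * (Dsq 0 (d s) * (4 * M)))) / m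
        + m * √(4 * M)) := by gcongr
    _ = K * (√(Dsq 0 (d s)) / m ^ 3 + √(√(9 * (Dsq 0 (d s) * (4 * M)))) / m)
        + K * (m * √(4 * M)) := by ring
    _ ≤ ε := by linarith

lemma tendsto_setIntegral_closedBall {f : E3 → ℝ} (hf : Integrable f) :
    Tendsto (fun n : ℕ => ∫ x in Metric.closedBall (0 : E3) n, f x) atTop (𝓝 (∫ x, f x)) := by
  have := tendsto_setIntegral_of_monotone (μ := volume) (f := f)
    (s := fun n : ℕ => Metric.closedBall (0 : E3) n)
    (fun n => measurableSet_closedBall)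
    (fun m n h => Metric.closedBall_subset_closedBall (by exact_mod_cast h))
    hf.integrableOn
  simpa only [Metric.iUnion_closedBall_nat, setIntegral_univ] using this

/-- Differentiability of `s ↦ ‖w s‖²_{L²}` when `∂ₛw` is bounded in `L² + L¹` and `w` is
bounded in `H²`. -/
lemma hasDerivAt_Dsq_zero {w w' a b : ℝ → E3 → ℝ} {α β t M : ℝ} (ht : t ∈ Set.Ioo α β)
    (hw : ∀ s ∈ Set.Ioo α β, ContDiff ℝ 2 (w s))
    (hi : ∀ s ∈ Set.Ioo α β, ∀ k ≤ 2, Integrable fun x => ‖iteratedFDeriv ℝ k (w s) x‖ ^ 2)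
    (hsup : ∀ s ∈ Set.Ioo α β, ∀ x, |w s x| ≤ M)
    (hD0 : ∀ s ∈ Set.Ioo α β, Dsq 0 (w s) ≤ M) (hD2 : ∀ s ∈ Set.Ioo α β, Dsq 2 (w s) ≤ M)
    (hwc : ContinuousOn (fun q : ℝ × E3 => w q.1 q.2) (Set.Ioo α β ×ˢ Set.univ))
    (hw'c : ContinuousOn (fun q : ℝ × E3 => w' q.1 q.2) (Set.Ioo α β ×ˢ Set.univ))
    (hd : ∀ s ∈ Set.Ioo α β, ∀ x, HasDerivAt (fun r => w r x) (w' s x) s)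
    (hb0 : ∀ s ∈ Set.Ioo α β, ∀ x, 0 ≤ b s x)
    (hab : ∀ s ∈ Set.Ioo α β, ∀ x, |w' s x| ≤ a s x + b s x)
    (hai : ∀ s ∈ Set.Ioo α β, Integrable fun x => a s x ^ 2)
    (hbi : ∀ s ∈ Set.Ioo α β, Integrable (b s))
    (haM : ∀ s ∈ Set.Ioo α β, ∫ x, a s x ^ 2 ≤ M) (hbM : ∀ s ∈ Set.Ioo α β, ∫ x, b s x ≤ M)
    (hdecay : Tendsto (w t) (cocompact E3) (𝓝 0)) :
    Integrable (fun x => w t x * w' t x) ∧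
      HasDerivAt (fun s => Dsq 0 (w s)) (2 * ∫ x, w t x * w' t x) t := by
  have hJ : Set.Ioo α β ∈ 𝓝 t := Ioo_mem_nhds ht.1 ht.2
  have hM : 0 ≤ M := (Dsq_nonneg 0 _).trans (hD0 t ht)
  have hi0 : ∀ s ∈ Set.Ioo α β, Integrable fun x => w s x ^ 2 := fun s hs => by
    simpa [norm_iteratedFDeriv_zero] using hi s hs 0 (by norm_num)
  have hwcs : ∀ s ∈ Set.Ioo α β, Continuous (w s) := fun s hs => (hw s hs).continuous
  have hw'cs : ∀ s ∈ Set.Ioo α β, Continuous (w' s) := fun s hs => by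
    rw [← continuousOn_univ]
    exact hw'c.comp (f := fun x : E3 => (s, x)) (by fun_prop) (fun x _ => ⟨hs, trivial⟩)
  have hInt : ∀ s ∈ Set.Ioo α β, Integrable fun x => 2 * (w s x * w' s x) := by
    intro s hs
    refine integrable_of_abs_le (continuous_const.mul ((hwcs s hs).mul (hw'cs s hs)))
      (((hi0 s hs).add (hai s hs)).add ((hbi s hs).const_mul (2 * M))) fun x => ?_
    simp only [Pi.add_apply]
    rw [abs_mul, abs_mul, abs_two]
    have h1 := hab s hs x
    have h2 := hsup s hs x
    have h3 := hb0 s hs x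
    have h4 := abs_nonneg (w s x)
    have h5 := mul_le_mul_of_nonneg_left h1 h4
    have h6 := mul_le_mul_of_nonneg_right h2 h3
    nlinarith [sq_nonneg (|w s x| - a s x), sq_abs (w s x)]
  set C := 5 * M + 4 * M * M
  set B : ℕ → Set E3 := fun n => Metric.closedBall (0 : E3) n
  have hBc : ∀ n, IsCompact (B n) := fun n => isCompact_closedBall _ _
  have hdi : ∀ s ∈ Set.Ioo α β, Integrable fun x => (w s x - w t x) ^ 2 := fun s hs => by
    simpa [norm_iteratedFDeriv_zero] using (integrable_sq_norm_iteratedFDeriv_sub (k := 0)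
      (hw s hs) (hw t ht) (by norm_num) (hi s hs 0 (by norm_num)) (hi t ht 0 (by norm_num))).1
  have hLip : ∀ s ∈ Set.Ioo α β, ∫ x, (w s x - w t x) ^ 2 ≤ C * |s - t| := by
    intro s hs
    refine le_of_tendsto (tendsto_setIntegral_closedBall (hdi s hs))
      (Eventually.of_forall fun n => ?_)
    have hder : ∀ r ∈ Set.Ioo α β, HasDerivAt (fun r => ∫ x in B n, (w r x - w t x) ^ 2)
        (∫ x in B n, 2 * (w r x - w t x) * w' r x) r := by
      intro r hr
      refine hasDerivAt_setIntegral_of_isCompact (hBc n) isOpen_Ioo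
        (g := fun r x => (w r x - w t x) ^ 2) (g' := fun r x => 2 * (w r x - w t x) * w' r x)
        (fun s hs => ((hwcs s hs).sub (hwcs t ht)).pow 2) ?_ ?_ hr
      · have hwt : Continuous fun q : ℝ × E3 => w t q.2 := (hwcs t ht).comp continuous_snd
        exact (continuousOn_const.mul (hwc.sub hwt.continuousOn)).mul hw'c
      · intro s hs x
        refine (((hd s hs x).sub_const (w t x)).pow 2).congr_deriv ?_
        simp
    have hbd : ∀ r ∈ Set.Ioo α β, ‖∫ x in B n, 2 * (w r x - w t x) * w' r x‖ ≤ C := by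
      intro r hr
      have hgi : Integrable fun x => 2 * w r x ^ 2 + 2 * w t x ^ 2 + a r x ^ 2
          + 4 * M * b r x :=
        ((((hi0 r hr).const_mul 2).add ((hi0 t ht).const_mul 2)).add (hai r hr)).add
          ((hbi r hr).const_mul (4 * M))
      have hpos : ∀ x, 0 ≤ 2 * w r x ^ 2 + 2 * w t x ^ 2 + a r x ^ 2 + 4 * M * b r x :=
        fun x => by have := hb0 r hr x; positivity
      refine (norm_integral_le_of_norm_le hgi.integrableOn
        (Eventually.of_forall fun x => ?_)).trans
        ((setIntegral_le_integral hgi (Eventually.of_forall hpos)).trans ?_)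
      · rw [norm_mul, norm_mul, Real.norm_two, Real.norm_eq_abs, Real.norm_eq_abs]
        have h1 := hab r hr x
        have h2 : |w r x - w t x| ≤ 2 * M :=
          (abs_sub _ _).trans (by linarith [hsup r hr x, hsup t ht x])
        have h3 := hb0 r hr x
        have h4 := abs_nonneg (w r x - w t x)
        have h5 := mul_le_mul_of_nonneg_left h1 h4
        have h6 := mul_le_mul_of_nonneg_right h2 h3
        nlinarith [sq_nonneg (|w r x - w t x| - a r x), sq_abs (w r x - w t x),
          sq_nonneg (w r x + w t x)]
      · rw [integral_add (f := fun x => 2 * w r x ^ 2 + 2 * w t x ^ 2 + a r x ^ 2)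
          ((((hi0 r hr).const_mul 2).add ((hi0 t ht).const_mul 2)).add (hai r hr))
          ((hbi r hr).const_mul (4 * M)),
          integral_add (f := fun x => 2 * w r x ^ 2 + 2 * w t x ^ 2)
          (((hi0 r hr).const_mul 2).add ((hi0 t ht).const_mul 2)) (hai r hr),
          integral_add ((hi0 r hr).const_mul 2) ((hi0 t ht).const_mul 2),
          integral_const_mul, integral_const_mul, integral_const_mul,
          ← Dsq_zero_eq, ← Dsq_zero_eq]
        have := mul_le_mul_of_nonneg_left (hbM r hr) hM
        linarith [hD0 r hr, hD0 t ht, haM r hr]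
    have := (convex_Ioo α β).norm_image_sub_le_of_norm_hasDerivWithin_le
      (fun r hr => (hder r hr).hasDerivWithinAt) hbd ht hs
    simp only [sub_self] at this
    refine (le_abs_self _).trans ?_
    simpa using this
  have hC0 : Tendsto (fun s => C * |s - t|) (𝓝 t) (𝓝 0) := by
    have hc : Continuous fun s => C * |s - t| := by fun_prop
    simpa using hc.tendsto t
  have hD0t : Tendsto (fun s => Dsq 0 (fun x => w s x - w t x)) (𝓝 t) (𝓝 0) := by
    refine squeeze_zero' (Eventually.of_forall fun s => Dsq_nonneg 0 _) ?_ hC0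
    filter_upwards [hJ] with s hs
    rw [Dsq_zero_eq]
    exact hLip s hs
  have hunif := fun (ε : ℝ) (hε : 0 < ε) =>
    eventually_abs_sub_le_of_tendsto_Dsq_zero hJ hw hi hD2 hD0t hε
  have hmain : HasDerivAt (fun s => ∫ x, w s x ^ 2) (∫ x, 2 * (w t x * w' t x)) t := by
    refine hasDerivAt_of_tendstoUniformlyOnFilter (l := (atTop : Filter ℕ))
      (f := fun n s => ∫ x in B n, w s x ^ 2)
      (f' := fun n s => ∫ x in B n, 2 * (w s x * w' s x))
      (g' := fun s => ∫ x, 2 * (w s x * w' s x)) ?_ ?_ ?_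
    · rw [Metric.tendstoUniformlyOnFilter_iff]
      intro ε hε
      obtain ⟨η, hη, hηε⟩ : ∃ η > 0, η * M < ε / 4 := by
        refine ⟨ε / (8 * (M + 1)), by positivity, ?_⟩
        rw [div_mul_eq_mul_div, div_lt_div_iff₀ (by positivity) (by norm_num)]
        nlinarith
      have htail : ∀ᶠ n : ℕ in atTop, 2 / η * ∫ x in (B n)ᶜ, w t x ^ 2 < ε / 4 := by
        have h1 := (tendsto_setIntegral_closedBall (hi0 t ht)).const_sub (∫ x, w t x ^ 2)
        have h2 : Tendsto (fun n : ℕ => 2 / η * ∫ x in (B n)ᶜ, w t x ^ 2) atTop (𝓝 0) := by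
          have h3 := h1.const_mul (2 / η)
          simp only [sub_self, mul_zero] at h3
          refine h3.congr fun n => ?_
          rw [← setIntegral_compl (hBc n).measurableSet (hi0 t ht)]
        exact h2.eventually_lt_const (by positivity)
      have hout : ∀ᶠ n : ℕ in atTop, ∀ x ∈ (B n)ᶜ, |w t x| ≤ η / 4 := by
        have h1 : {x | |w t x| ≤ η / 4} ∈ cocompact E3 := by
          have h2 := hdecay.abs
          rw [abs_zero] at h2
          exact h2.eventually_le_const (by positivity)
        obtain ⟨R, hR⟩ := Metric.closedBall_compl_subset_of_mem_cocompact h1 0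
        filter_upwards [eventually_ge_atTop ⌈R⌉₊] with n hn x hx
        refine hR fun hx' => hx ?_
        exact Metric.closedBall_subset_closedBall (Nat.ceil_le.1 hn) hx'
      have hnear : ∀ᶠ s in 𝓝 t, 2 / η * (C * |s - t|) < ε / 4 := by
        have h1 := hC0.const_mul (2 / η)
        rw [mul_zero] at h1
        exact h1.eventually_lt_const (by positivity)
      have hev := (htail.and hout).prod_mk ((Filter.Eventually.and hJ hnear).and (hunif (η / 4) (by positivity)))
      filter_upwards [hev] with q hq
      obtain ⟨⟨h1, h2⟩, ⟨hs, h3⟩, h4⟩ := hq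
      set n := q.1
      set s := q.2
      change s ∈ Set.Ioo α β at hs
      have hgi : Integrable fun x => 2 / η * w t x ^ 2 + 2 / η * (w s x - w t x) ^ 2
          + η * a s x ^ 2 + η * b s x :=
        ((((hi0 t ht).const_mul _).add ((hdi s hs).const_mul _)).add
          ((hai s hs).const_mul _)).add ((hbi s hs).const_mul _)
      rw [dist_eq_norm, ← setIntegral_compl (hBc n).measurableSet (hInt s hs)]
      have hle : ‖∫ x in (B n)ᶜ, 2 * (w s x * w' s x)‖ ≤ ∫ x in (B n)ᶜ,
          (2 / η * w t x ^ 2 + 2 / η * (w s x - w t x) ^ 2 + η * a s x ^ 2 + η * b s x) := by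
        refine norm_integral_le_of_norm_le hgi.integrableOn ?_
        filter_upwards [ae_restrict_mem (hBc n).measurableSet.compl] with x hx
        rw [norm_mul, norm_mul, Real.norm_two, Real.norm_eq_abs, Real.norm_eq_abs]
        have k1 := hab s hs x
        have k2 : |w s x| ≤ η / 2 := by
          have e : w s x = (w s x - w t x) + w t x := by ring
          rw [e]
          exact (abs_add_le _ _).trans (by linarith [h4 x, h2 x hx])
        have k3 := hb0 s hs x
        have k4 := abs_nonneg (w s x)
        have k5 := mul_le_mul_of_nonneg_left k1 k4
        have k6 := mul_le_mul_of_nonneg_right k2 k3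
        have k7 : 2 * (|w s x| * a s x) ≤ w s x ^ 2 / η + η * a s x ^ 2 := by
          have : w s x ^ 2 / η + η * a s x ^ 2 - 2 * (|w s x| * a s x)
              = (|w s x| - η * a s x) ^ 2 / η := by
            field_simp
            rw [← sq_abs (w s x)]
            ring
          have : 0 ≤ (|w s x| - η * a s x) ^ 2 / η := by positivity
          linarith
        have k8 : w s x ^ 2 / η ≤ 2 / η * w t x ^ 2 + 2 / η * (w s x - w t x) ^ 2 := by
          rw [← mul_add, div_mul_eq_mul_div]
          gcongr
          nlinarith [sq_nonneg (w s x - 2 * w t x)]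
        nlinarith
      have hbc : ∫ x in (B n)ᶜ, b s x ≤ M :=
        (setIntegral_le_integral (hbi s hs) (Eventually.of_forall (hb0 s hs))).trans (hbM s hs)
      have hac : ∫ x in (B n)ᶜ, a s x ^ 2 ≤ M :=
        (setIntegral_le_integral (hai s hs) (Eventually.of_forall fun x => sq_nonneg _)).trans
          (haM s hs)
      have hdc : ∫ x in (B n)ᶜ, (w s x - w t x) ^ 2 ≤ C * |s - t| :=
        (setIntegral_le_integral (hdi s hs) (Eventually.of_forall fun x => sq_nonneg _)).trans
          (hLip s hs)
      refine hle.trans_lt ?_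
      have j1 := ((hi0 t ht).const_mul (2 / η)).restrict (s := (B n)ᶜ)
      have j2 := ((hdi s hs).const_mul (2 / η)).restrict (s := (B n)ᶜ)
      have j3 := ((hai s hs).const_mul η).restrict (s := (B n)ᶜ)
      have j4 := ((hbi s hs).const_mul η).restrict (s := (B n)ᶜ)
      have j12 : Integrable (fun x => 2 / η * w t x ^ 2 + 2 / η * (w s x - w t x) ^ 2)
        (volume.restrict (B n)ᶜ) := j1.add j2
      have j123 : Integrable (fun x => 2 / η * w t x ^ 2 + 2 / η * (w s x - w t x) ^ 2
        + η * a s x ^ 2) (volume.restrict (B n)ᶜ) := j12.add j3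
      rw [integral_add j123 j4, integral_add j12 j3, integral_add j1 j2,
        integral_const_mul, integral_const_mul, integral_const_mul, integral_const_mul]
      have e1 := mul_le_mul_of_nonneg_left hbc hη.le
      have e2 := mul_le_mul_of_nonneg_left hac hη.le
      have e3 := mul_le_mul_of_nonneg_left hdc (by positivity : 0 ≤ 2 / η)
      linarith
    · have hev : ∀ᶠ q : ℕ × ℝ in atTop ×ˢ 𝓝 t, q.2 ∈ Set.Ioo α β :=
        tendsto_snd.eventually hJ
      filter_upwards [hev] with q hq
      refine hasDerivAt_setIntegral_of_isCompact (hBc q.1) isOpen_Ioo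
        (g := fun r x => w r x ^ 2) (g' := fun r x => 2 * (w r x * w' r x))
        (fun s hs => (hwcs s hs).pow 2) (continuousOn_const.mul (hwc.mul hw'c)) ?_ hq
      intro s hs x
      refine ((hd s hs x).pow 2).congr_deriv ?_
      simp; ring
    · filter_upwards [hJ] with s hs using tendsto_setIntegral_closedBall (hi0 s hs)
  refine ⟨?_, ?_⟩
  · refine ((hInt t ht).const_mul (1 / 2)).congr (Eventually.of_forall fun x => ?_)
    simp only; ring
  · rw [integral_const_mul] at hmain
    simpa only [Dsq_zero_eq] using hmain

lemma contDiff_slice {w : ℝ → E3 → ℝ} {T s : ℝ}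
    (h : ContDiffOn ℝ (⊤ : ℕ∞) (fun q : ℝ × E3 => w q.1 q.2) (Set.Icc 0 T ×ˢ Set.univ))
    (hs : s ∈ Set.Icc 0 T) : ContDiff ℝ 2 (w s) := by
  rw [← contDiffOn_univ]
  have h2 : ContDiffOn ℝ 2 (fun q : ℝ × E3 => w q.1 q.2) (Set.Icc 0 T ×ˢ Set.univ) :=
    h.of_le (WithTop.coe_le_coe.2 (le_top : (2 : ℕ∞) ≤ ⊤))
  exact h2.comp (f := fun x : E3 => (s, x)) (by fun_prop) (fun x _ => ⟨hs, trivial⟩)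

lemma continuousOn_and_hasDerivAt_of_contDiffOn {w : ℝ → E3 → ℝ} {T : ℝ}
    (h : ContDiffOn ℝ (⊤ : ℕ∞) (fun q : ℝ × E3 => w q.1 q.2) (Set.Icc 0 T ×ˢ Set.univ)) :
    ContinuousOn (fun q : ℝ × E3 => w q.1 q.2) (Set.Ioo 0 T ×ˢ Set.univ) ∧
    ContinuousOn (fun q : ℝ × E3 => deriv (fun r => w r q.2) q.1) (Set.Ioo 0 T ×ˢ Set.univ) ∧
    ∀ s ∈ Set.Ioo 0 T, ∀ x, HasDerivAt (fun r => w r x) (deriv (fun r => w r x) s) s := by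
  have ho : IsOpen (Set.Ioo 0 T ×ˢ (Set.univ : Set E3)) := isOpen_Ioo.prod isOpen_univ
  have h' : ContDiffOn ℝ 1 (fun q : ℝ × E3 => w q.1 q.2) (Set.Ioo 0 T ×ˢ Set.univ) :=
    (h.mono (Set.prod_mono Set.Ioo_subset_Icc_self subset_rfl)).of_le
      (by exact_mod_cast le_top)
  have hd : ∀ s ∈ Set.Ioo 0 T, ∀ x, HasDerivAt (fun r => w r x)
      (fderiv ℝ (fun q : ℝ × E3 => w q.1 q.2) (s, x) (1, 0)) s := by
    intro s hs x
    have h1 := ((h'.differentiableOn (by norm_num)).differentiableAt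
      (ho.mem_nhds (⟨hs, trivial⟩ : (s, x) ∈ Set.Ioo 0 T ×ˢ Set.univ))).hasFDerivAt
    have h2 : HasDerivAt (fun r : ℝ => (r, x)) ((1 : ℝ), (0 : E3)) s :=
      (hasDerivAt_id s).prodMk (hasDerivAt_const s x)
    exact h1.comp_hasDerivAt s h2
  refine ⟨h'.continuousOn, ?_, fun s hs x => (hd s hs x).differentiableAt.hasDerivAt⟩
  refine ((h'.continuousOn_fderiv_of_isOpen ho le_rfl).clm_apply
    (continuousOn_const (c := ((1 : ℝ), (0 : E3))))).congr ?_
  rintro ⟨s, x⟩ ⟨hs, -⟩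
  exact (hd s hs x).deriv

/-- Green's identity for a composite weight `F` with `∇F = A ∇f + B ∇h`. -/
lemma integral_mul_lap_of_hasFDerivAt {F f h g A B : E3 → ℝ} {C : ℝ} (hF : ContDiff ℝ 1 F)
    (hg : ContDiff ℝ 2 g)
    (hFd : ∀ x, HasFDerivAt F (A x • fderiv ℝ f x + B x • fderiv ℝ h x) x)
    (hA : ∀ x, |A x| ≤ C) (hB : ∀ x, |B x| ≤ C)
    (hF0 : Integrable fun x => F x ^ 2)
    (hf1 : Integrable (gdot f f)) (hh1 : Integrable (gdot h h))
    (hg1 : Integrable (gdot g g)) (hg2 : Integrable fun x => ‖iteratedFDeriv ℝ 2 g x‖ ^ 2) :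
    Integrable (fun x => F x * lap g x + (A x * gdot f g x + B x * gdot h g x)) ∧
      ∫ x, (F x * lap g x + (A x * gdot f g x + B x * gdot h g x)) = 0 := by
  have hpd : ∀ i x, pd i F x = A x * pd i f x + B x * pd i h x := fun i x => by
    simp [pd, (hFd x).fderiv]
  have e : ∀ x, gdot F g x = A x * gdot f g x + B x * gdot h g x := fun x => by
    simp only [gdot, Fin.sum_univ_three, hpd]
    ring
  have hF1 : Integrable (gdot F F) := by
    refine integrable_of_abs_le (continuous_gdot hF hF)
      ((hf1.add hh1).const_mul (2 * C ^ 2)) fun x => ?_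
    rw [abs_of_nonneg (gdot_self_nonneg F x)]
    have hA2 : A x ^ 2 ≤ C ^ 2 := sq_le_sq.2 ((hA x).trans (le_abs_self C))
    have hB2 : B x ^ 2 ≤ C ^ 2 := sq_le_sq.2 ((hB x).trans (le_abs_self C))
    have e2 : gdot F F x ≤ 2 * A x ^ 2 * gdot f f x + 2 * B x ^ 2 * gdot h h x := by
      simp only [gdot, Fin.sum_univ_three, hpd]
      nlinarith [sq_nonneg (A x * pd 0 f x - B x * pd 0 h x),
        sq_nonneg (A x * pd 1 f x - B x * pd 1 h x), sq_nonneg (A x * pd 2 f x - B x * pd 2 h x)]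
    have h1 := mul_le_mul_of_nonneg_right hA2 (gdot_self_nonneg f x)
    have h2 := mul_le_mul_of_nonneg_right hB2 (gdot_self_nonneg h x)
    simp only [Pi.add_apply]
    linarith
  have := integral_mul_lap_add_gdot hF hg hF0 hF1 hg1 hg2
  simpa only [e] using this

lemma gdot_weighted (f g : E3 → ℝ) (x : E3) :
    0 ≤ 49 * gdot f f x + 168 * gdot f g x + 144 * gdot g g x := by
  simp only [gdot, Fin.sum_univ_three]
  nlinarith [sq_nonneg (7 * pd 0 f x + 12 * pd 0 g x), sq_nonneg (7 * pd 1 f x + 12 * pd 1 g x),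
    sq_nonneg (7 * pd 2 f x + 12 * pd 2 g x)]

lemma abs_mul_le_mul_of_le {k N g G : ℝ} (hk : |k| ≤ N) (hg : |g| ≤ G) : |k * g| ≤ N * G := by
  rw [abs_mul]
  have := (abs_nonneg _).trans hk
  gcongr

/-- Coercivity of the quadratic form left after integrating by parts. -/
lemma energy_density_le {c m a b h q guu gvv ghh gff guh gvh guf gvf ghf lu lv lh : ℝ}
    (hc : 1 < c) (hm : m ≤ 1 / 2) (ha : |a| ≤ m) (hb : |b| ≤ m) (hh : |h| ≤ m)
    (hq : q * (2 + a) = 1)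
    (pu : 0 ≤ guu) (pv : 0 ≤ gvv) (ph : 0 ≤ ghh) (pf : 0 ≤ gff)
    (huh : |guh| ≤ (guu + ghh) / 2) (hvh : |gvh| ≤ (gvv + ghh) / 2)
    (huf : |guf| ≤ (guu + gff) / 2) (hvf : |gvf| ≤ (gvv + gff) / 2)
    (hhf : |ghf| ≤ (ghh + gff) / 2) (hw : 0 ≤ 49 * guu + 168 * guh + 144 * ghh) :
    a * (lu + 2 * lh + h * lu + a * lh + 2 * guh - gvf - b ^ 2)
      + b * (lv - 2 * b + h * lv + b * lh + 2 * gvh - guf - a * b)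
      + 2 * h * ((3 / 2) * lh + (1 / 2) * lu + h * lh - (a * q / 2) * lh
          + ((2 * h ^ 2 + 4 * h - a) * q / 2) * lu + (c + 1) * ghh
          + (c + 3) * ((1 + h) * q) * guh - 2 * ((1 + h) * q) * gvf
          - (c + 2) * (b * q) * ghf - ((1 + h) * q) * b ^ 2 + gff)
      - ((a * (1 + h)) * lu + ((1 + h) * guu + a * guh))
      - ((a * (2 + a)) * lh + ((2 + 2 * a) * guh))
      - ((b * (1 + h)) * lv + ((1 + h) * gvv + b * gvh))
      - (b ^ 2 * lh + 2 * b * gvh)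
      - ((2 * h * (1 + h + q)) * lh + (-(2 * h * q ^ 2) * guh + 2 * (1 + 2 * h + q) * ghh))
      - ((2 * h * (1 + h) ^ 2 * q) * lu
          + (-(2 * h * (1 + h) ^ 2 * q ^ 2) * guu
            + (2 * (1 + h) ^ 2 * q + 4 * h * (1 + h) * q) * guh))
      ≤ -(1 / 8) * (guu + gvv + ghh + b ^ 2)
        + 60 * (c + 1) * m * (guu + gvv + ghh + b ^ 2 + gff) := by
  have hm0 : 0 ≤ m := (abs_nonneg _).trans ha
  have ha' := abs_le.1 ha
  have hh' := abs_le.1 hh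
  have hb' := abs_le.1 hb
  have q0 : 0 < q := pos_of_mul_pos_left (by rw [hq]; norm_num) (by linarith : 0 ≤ 2 + a)
  have q1 : q ≤ 2 / 3 := by nlinarith
  obtain ⟨p, hp⟩ : ∃ p, p = (1 + h) * q := ⟨_, rfl⟩
  have p0 : 0 ≤ p := by rw [hp]; exact mul_nonneg (by linarith) q0.le
  have p1 : p ≤ 1 := by rw [hp]; nlinarith
  have hh1 : |h| ≤ 1 := by linarith
  have kaq : |a * q| ≤ m * 1 :=
    abs_mul_le_mul_of_le ha (by rw [abs_of_pos q0]; linarith)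
  have khp : |h * p| ≤ m * 1 := abs_mul_le_mul_of_le hh (by rw [abs_of_nonneg p0]; linarith)
  have kbq : |b * q| ≤ 1 := (abs_mul_le_mul_of_le hb
    (by rw [abs_of_pos q0]; linarith : |q| ≤ 1)).trans (by linarith)
  have b1 : |h * (2 * p ^ 2 - 1)| ≤ m * 1 :=
    abs_mul_le_mul_of_le hh (by rw [abs_le]; constructor <;> nlinarith)
  have b2 : |h * (2 * c * p - 2 * q + 2 * q ^ 2)| ≤ m * (2 * c + 1) := by
    refine abs_mul_le_mul_of_le hh ?_
    have : 0 ≤ c * p := by positivity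
    have : c * p ≤ c := mul_le_of_le_one_right (by linarith) p1
    rw [abs_le]; constructor <;> nlinarith
  have b3 : |h * (2 * (c + 1) - 4)| ≤ m * (2 * c + 2) :=
    abs_mul_le_mul_of_le hh (by rw [abs_le]; constructor <;> linarith)
  have b4 : |h * (-2 * (c + 2) * (b * q))| ≤ m * ((2 * (c + 2)) * 1) := by
    refine abs_mul_le_mul_of_le hh (abs_mul_le_mul_of_le ?_ kbq)
    rw [abs_le]; constructor <;> linarith
  rw [mul_one] at kaq khp b1
  have hcm : m ≤ c * m := by nlinarith
  have e1 : h * (2 * p ^ 2 - 1) * guu ≤ 20 * (c + 1) * m * guu :=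
    (le_abs_self _).trans (abs_mul_le_mul_of_le (b1.trans (by linarith only [hm0, hcm])) (abs_of_nonneg pu).le)
  have e2 : (-a + a * q + h * (2 * c * p - 2 * q + 2 * q ^ 2)) * guh
      ≤ 20 * (c + 1) * m * ((guu + ghh) / 2) := by
    refine (le_abs_self _).trans (abs_mul_le_mul_of_le ?_ huh)
    obtain ⟨ha_l, ha_r⟩ := abs_le.1 ha
    obtain ⟨kaq_l, kaq_r⟩ := abs_le.1 kaq
    obtain ⟨b2_l, b2_r⟩ := abs_le.1 b2
    rw [abs_le]
    constructor <;> linarith only [hm0, hcm, ha_l, ha_r, kaq_l, kaq_r, b2_l, b2_r]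
  have e3 : -h * gvv ≤ 20 * (c + 1) * m * gvv := by
    refine (le_abs_self _).trans (abs_mul_le_mul_of_le ?_ (abs_of_nonneg pv).le)
    rw [abs_neg]; linarith only [ha, hb, hh, hm0, hcm]
  have e4 : -b * gvh ≤ 20 * (c + 1) * m * ((gvv + ghh) / 2) := by
    refine (le_abs_self _).trans (abs_mul_le_mul_of_le ?_ hvh)
    rw [abs_neg]; linarith only [ha, hb, hh, hm0, hcm]
  have e5 : (a * q + h * (2 * (c + 1) - 4)) * ghh ≤ 20 * (c + 1) * m * ghh := by
    refine (le_abs_self _).trans (abs_mul_le_mul_of_le ?_ (abs_of_nonneg ph).le)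
    obtain ⟨kaq_l, kaq_r⟩ := abs_le.1 kaq
    obtain ⟨b3_l, b3_r⟩ := abs_le.1 b3
    rw [abs_le]
    constructor <;> linarith only [hm0, hcm, kaq_l, kaq_r, b3_l, b3_r]
  have e6 : (-a - 4 * (h * p)) * gvf ≤ 20 * (c + 1) * m * ((gvv + gff) / 2) := by
    refine (le_abs_self _).trans (abs_mul_le_mul_of_le ?_ hvf)
    obtain ⟨ha_l, ha_r⟩ := abs_le.1 ha
    obtain ⟨khp_l, khp_r⟩ := abs_le.1 khp
    rw [abs_le]
    constructor <;> linarith only [hm0, hcm, ha_l, ha_r, khp_l, khp_r]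
  have e7 : -b * guf ≤ 20 * (c + 1) * m * ((guu + gff) / 2) := by
    refine (le_abs_self _).trans (abs_mul_le_mul_of_le ?_ huf)
    rw [abs_neg]; linarith only [ha, hb, hh, hm0, hcm]
  have e8 : h * (-2 * (c + 2) * (b * q)) * ghf ≤ 20 * (c + 1) * m * ((ghh + gff) / 2) :=
    (le_abs_self _).trans (abs_mul_le_mul_of_le (b4.trans (by linarith only [hm0, hcm])) hhf)
  have e9 : (-2 * a - 2 * (h * p)) * b ^ 2 ≤ 20 * (c + 1) * m * b ^ 2 := by
    refine (le_abs_self _).trans (abs_mul_le_mul_of_le ?_ (abs_of_nonneg (sq_nonneg b)).le)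
    obtain ⟨ha_l, ha_r⟩ := abs_le.1 ha
    obtain ⟨khp_l, khp_r⟩ := abs_le.1 khp
    rw [abs_le]
    constructor <;> linarith only [hm0, hcm, ha_l, ha_r, khp_l, khp_r]
  have e10 : 2 * h * gff ≤ 20 * (c + 1) * m * gff := by
    refine (le_abs_self _).trans (abs_mul_le_mul_of_le ?_ (abs_of_nonneg pf).le)
    obtain ⟨hh_l, hh_r⟩ := abs_le.1 hh
    rw [abs_le]
    constructor <;> linarith only [hm0, hcm, hh_l, hh_r]
  have n0 : 0 ≤ 20 * (c + 1) * m := by positivity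
  have n1 := mul_nonneg n0 pu
  have n2 := mul_nonneg n0 pv
  have n3 := mul_nonneg n0 ph
  have n4 := mul_nonneg n0 pf
  have n5 := mul_nonneg n0 (sq_nonneg b)
  have hb2 := sq_nonneg b
  calc _ = -guu - 3 * guh - 3 * ghh - gvv - 2 * b ^ 2
        + (h * (2 * p ^ 2 - 1) * guu
          + (-a + a * q + h * (2 * c * p - 2 * q + 2 * q ^ 2)) * guh
          + -h * gvv + -b * gvh + (a * q + h * (2 * (c + 1) - 4)) * ghh
          + (-a - 4 * (h * p)) * gvf + -b * guf + h * (-2 * (c + 2) * (b * q)) * ghf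
          + (-2 * a - 2 * (h * p)) * b ^ 2 + 2 * h * gff) := by
        rw [hp]
        linear_combination (-(h * lu) - h * lh - guh - ghh) * hq
    _ ≤ _ := by
        linarith only [e1, e2, e3, e4, e5, e6, e7, e8, e9, e10, n1, n2, n3, n4, n5, pu, pv, ph, hb2, hw]

set_option maxHeartbeats 1000000 in
/-- The time derivatives are controlled by a sum of an `L²` and an `L¹` quantity. -/
lemma abs_rhs_le {c a b h q guu gvv ghh gff guh gvh guf gvf ghf lu lv lh : ℝ}
    (hc : 1 < c) (ha : |a| ≤ 1 / 2) (hb : |b| ≤ 1 / 2) (hh : |h| ≤ 1 / 2)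
    (hq : q * (2 + a) = 1)
    (pu : 0 ≤ guu) (pv : 0 ≤ gvv) (ph : 0 ≤ ghh) (pf : 0 ≤ gff)
    (huh : |guh| ≤ (guu + ghh) / 2) (hvh : |gvh| ≤ (gvv + ghh) / 2)
    (huf : |guf| ≤ (guu + gff) / 2) (hvf : |gvf| ≤ (gvv + gff) / 2)
    (hhf : |ghf| ≤ (ghh + gff) / 2) :
    |lu + 2 * lh + h * lu + a * lh + 2 * guh - gvf - b ^ 2|
        ≤ 20 * (c + 1) * (|lu| + |lv| + |lh| + |b|)
          + 20 * (c + 1) * (guu + gvv + ghh + gff + a ^ 2 + b ^ 2) ∧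
    |lv - 2 * b + h * lv + b * lh + 2 * gvh - guf - a * b|
        ≤ 20 * (c + 1) * (|lu| + |lv| + |lh| + |b|)
          + 20 * (c + 1) * (guu + gvv + ghh + gff + a ^ 2 + b ^ 2) ∧
    |(3 / 2) * lh + (1 / 2) * lu + h * lh - (a * q / 2) * lh
          + ((2 * h ^ 2 + 4 * h - a) * q / 2) * lu + (c + 1) * ghh
          + (c + 3) * ((1 + h) * q) * guh - 2 * ((1 + h) * q) * gvf
          - (c + 2) * (b * q) * ghf - ((1 + h) * q) * b ^ 2 + gff|
        ≤ 20 * (c + 1) * (|lu| + |lv| + |lh| + |b|)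
          + 20 * (c + 1) * (guu + gvv + ghh + gff + a ^ 2 + b ^ 2) := by
  have ha' := abs_le.1 ha
  have hh' := abs_le.1 hh
  have hb' := abs_le.1 hb
  have q0 : 0 < q := pos_of_mul_pos_left (by rw [hq]; norm_num) (by linarith : 0 ≤ 2 + a)
  have q1 : q ≤ 2 / 3 := by nlinarith
  have p0 : 0 ≤ (1 + h) * q := mul_nonneg (by linarith) q0.le
  have p1 : (1 + h) * q ≤ 1 := by nlinarith
  have hq' : |q| ≤ 2 / 3 := by rwa [abs_of_pos q0]
  have kaq : |a * q| ≤ 1 / 2 * (2 / 3) := abs_mul_le_mul_of_le ha hq'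
  have kbq : |b * q| ≤ 1 / 2 * (2 / 3) := abs_mul_le_mul_of_le hb hq'
  have hb2 := sq_nonneg b
  have ha2 := sq_nonneg a
  have t1 := abs_mul_le_mul_of_le hh (le_refl |lu|)
  have t2 := abs_mul_le_mul_of_le ha (le_refl |lh|)
  have t3 := abs_mul_le_mul_of_le hh (le_refl |lv|)
  have t4 := abs_mul_le_mul_of_le hb (le_refl |lh|)
  have t5 : |(3 / 2 + h - a * q / 2) * lh| ≤ 3 * |lh| := by
    refine abs_mul_le_mul_of_le ?_ le_rfl
    obtain ⟨k_l, k_r⟩ := abs_le.1 kaq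
    rw [abs_le]
    constructor <;> linarith only [k_l, k_r, hh'.1, hh'.2]
  have t6 : |(1 / 2 + (2 * h ^ 2 + 4 * h - a) * q / 2) * lu| ≤ 3 * |lu| := by
    refine abs_mul_le_mul_of_le ?_ le_rfl
    have : |(2 * h ^ 2 + 4 * h - a) * q| ≤ 4 * (2 / 3) := by
      refine abs_mul_le_mul_of_le ?_ hq'
      rw [abs_le]
      constructor <;> nlinarith
    obtain ⟨k_l, k_r⟩ := abs_le.1 this
    rw [abs_le]
    constructor <;> linarith only [k_l, k_r]
  have t7 : |(c + 3) * ((1 + h) * q) * guh| ≤ (c + 3) * 1 * ((guu + ghh) / 2) := by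
    refine abs_mul_le_mul_of_le (abs_mul_le_mul_of_le ?_ ?_) huh
    · rw [abs_of_pos (by linarith)]
    · rwa [abs_of_nonneg p0]
  have t8 : |2 * ((1 + h) * q) * gvf| ≤ 2 * 1 * ((gvv + gff) / 2) := by
    refine abs_mul_le_mul_of_le (abs_mul_le_mul_of_le ?_ ?_) hvf
    · rw [abs_two]
    · rwa [abs_of_nonneg p0]
  have t9 : |(c + 2) * (b * q) * ghf| ≤ (c + 2) * 1 * ((ghh + gff) / 2) := by
    refine abs_mul_le_mul_of_le (abs_mul_le_mul_of_le ?_ ?_) hhf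
    · rw [abs_of_pos (by linarith)]
    · linarith
  have t10 : |(1 + h) * q * b ^ 2| ≤ 1 * b ^ 2 := by
    refine abs_mul_le_mul_of_le ?_ (abs_of_nonneg hb2).le
    rwa [abs_of_nonneg p0]
  have t11 : |a * b| ≤ a ^ 2 + b ^ 2 := by
    rw [abs_le]
    constructor <;> nlinarith [sq_nonneg (a + b), sq_nonneg (a - b)]
  have c1 := mul_nonneg (by linarith : 0 ≤ c - 1) (abs_nonneg lu)
  have c2 := mul_nonneg (by linarith : 0 ≤ c - 1) (abs_nonneg lv)
  have c3 := mul_nonneg (by linarith : 0 ≤ c - 1) (abs_nonneg lh)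
  have c4 := mul_nonneg (by linarith : 0 ≤ c - 1) (abs_nonneg b)
  have c5 := mul_nonneg (by linarith : 0 ≤ c - 1) pu
  have c6 := mul_nonneg (by linarith : 0 ≤ c - 1) pv
  have c7 := mul_nonneg (by linarith : 0 ≤ c - 1) ph
  have c8 := mul_nonneg (by linarith : 0 ≤ c - 1) pf
  have c9 := mul_nonneg (by linarith : 0 ≤ c - 1) ha2
  have c10 := mul_nonneg (by linarith : 0 ≤ c - 1) hb2
  have d1 := abs_nonneg lu
  have d2 := abs_nonneg lv
  have d3 := abs_nonneg lh
  have d4 := abs_nonneg b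
  obtain ⟨a1, a1'⟩ := abs_le.1 (le_refl |lu|)
  obtain ⟨a2, a2'⟩ := abs_le.1 (le_refl |lv|)
  obtain ⟨a3, a3'⟩ := abs_le.1 (le_refl |lh|)
  obtain ⟨a4, a4'⟩ := abs_le.1 (le_refl |b|)
  obtain ⟨g1, g1'⟩ := abs_le.1 huh
  obtain ⟨g2, g2'⟩ := abs_le.1 hvh
  obtain ⟨g3, g3'⟩ := abs_le.1 huf
  obtain ⟨g4, g4'⟩ := abs_le.1 hvf
  obtain ⟨s1, s1'⟩ := abs_le.1 t1
  obtain ⟨s2, s2'⟩ := abs_le.1 t2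
  obtain ⟨s3, s3'⟩ := abs_le.1 t3
  obtain ⟨s4, s4'⟩ := abs_le.1 t4
  obtain ⟨s5, s5'⟩ := abs_le.1 t5
  obtain ⟨s6, s6'⟩ := abs_le.1 t6
  obtain ⟨s7, s7'⟩ := abs_le.1 t7
  obtain ⟨s8, s8'⟩ := abs_le.1 t8
  obtain ⟨s9, s9'⟩ := abs_le.1 t9
  obtain ⟨s10, s10'⟩ := abs_le.1 t10
  obtain ⟨s11, s11'⟩ := abs_le.1 t11
  refine ⟨abs_le.2 ⟨?_, ?_⟩, abs_le.2 ⟨?_, ?_⟩, abs_le.2 ⟨?_, ?_⟩⟩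
  · linarith only [a1, a3, s1, s2, g1, g4',
      c1, c2, c3, c4, c5, c6, c7, c8, c9, c10, d1, d2, d3, d4, pu, pv, ph, pf, ha2, hb2]
  · linarith only [a1', a3', s1', s2', g1', g4,
      c1, c2, c3, c4, c5, c6, c7, c8, c9, c10, d1, d2, d3, d4, pu, pv, ph, pf, ha2, hb2]
  · linarith only [a2, a4, a4', s3, s4, g2, g3', s11',
      c1, c2, c3, c4, c5, c6, c7, c8, c9, c10, d1, d2, d3, d4, pu, pv, ph, pf, ha2, hb2]
  · linarith only [a2', a4', a4, s3', s4', g2', g3, s11,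
      c1, c2, c3, c4, c5, c6, c7, c8, c9, c10, d1, d2, d3, d4, pu, pv, ph, pf, ha2, hb2]
  · linarith only [s5, s6, s7, s8', s9', s10',
      c1, c2, c3, c4, c5, c6, c7, c8, c9, c10, d1, d2, d3, d4, pu, pv, ph, pf, ha2, hb2]
  · linarith only [s5', s6', s7', s8, s9, s10,
      c1, c2, c3, c4, c5, c6, c7, c8, c9, c10, d1, d2, d3, d4, pu, pv, ph, pf, ha2, hb2]

lemma integral_add_eq_zero {f g : E3 → ℝ} (hf : Integrable f ∧ ∫ x, f x = 0)
    (hg : Integrable g ∧ ∫ x, g x = 0) :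
    Integrable (fun x => f x + g x) ∧ ∫ x, (f x + g x) = 0 :=
  ⟨hf.1.add hg.1, by rw [integral_add hf.1 hg.1, hf.2, hg.2, add_zero]⟩

lemma integrable_sq_mul_of_abs_le {k w : E3 → ℝ} {C : ℝ} (hk : Continuous k) (hw : Continuous w)
    (hC : ∀ x, |k x| ≤ C) (hi : Integrable fun x => w x ^ 2) :
    Integrable fun x => (w x * k x) ^ 2 := by
  refine integrable_of_abs_le ((hw.mul hk).pow 2) (hi.const_mul (C ^ 2)) fun x => ?_
  rw [abs_of_nonneg (sq_nonneg _), mul_pow, mul_comm]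
  exact mul_le_mul_of_nonneg_right (sq_le_sq.2 ((hC x).trans (le_abs_self C))) (sq_nonneg _)

/-- The integrated energy inequality at a fixed time. -/
lemma integral_energy_le {c m : ℝ} {u v h f u' v' h' : E3 → ℝ} (hc : 1 < c) (hm : m ≤ 1 / 2)
    (hu : ContDiff ℝ 2 u) (hv : ContDiff ℝ 2 v) (hh : ContDiff ℝ 2 h)
    (bu : ∀ x, |u x| ≤ m) (bv : ∀ x, |v x| ≤ m) (bh : ∀ x, |h x| ≤ m)
    (iu : ∀ k ≤ 2, Integrable fun x => ‖iteratedFDeriv ℝ k u x‖ ^ 2)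
    (iv : ∀ k ≤ 2, Integrable fun x => ‖iteratedFDeriv ℝ k v x‖ ^ 2)
    (ih : ∀ k ≤ 2, Integrable fun x => ‖iteratedFDeriv ℝ k h x‖ ^ 2)
    (jf : Integrable (gdot f f))
    (eu : ∀ x, u' x = lap u x + 2 * lap h x + h x * lap u x + u x * lap h x
      + 2 * gdot h u x - gdot v f x - v x ^ 2)
    (ev : ∀ x, v' x = lap v x - 2 * v x + h x * lap v x + v x * lap h x
      + 2 * gdot h v x - gdot u f x - u x * v x)
    (eh : ∀ x, h' x = (3 / 2) * lap h x + (1 / 2) * lap u x + h x * lap h x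
      - (u x / (2 * (2 + u x))) * lap h x
      + ((2 * h x ^ 2 + 4 * h x - u x) / (2 * (2 + u x))) * lap u x
      + (c + 1) * gdot h h x + (c + 3) * ((1 + h x) / (2 + u x)) * gdot u h x
      - 2 * ((1 + h x) / (2 + u x)) * gdot v f x
      - (c + 2) * (v x / (2 + u x)) * gdot h f x
      - ((1 + h x) / (2 + u x)) * v x ^ 2 + gdot f f x)
    (iX : Integrable fun x => u x * u' x + v x * v' x + 2 * h x * h' x) :
    ∫ x, (u x * u' x + v x * v' x + 2 * h x * h' x) ≤
      -(1 / 8) * (Dsq 1 u + Dsq 1 v + Dsq 1 h + Dsq 0 v)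
        + 60 * (c + 1) * m * (Dsq 1 u + Dsq 1 v + Dsq 1 h + Dsq 0 v + Dsq 1 f) := by
  have cu := hu.continuous
  have cv := hv.continuous
  have ch := hh.continuous
  have su : Integrable fun x => u x ^ 2 := by simpa using iu 0 (by norm_num)
  have sv : Integrable fun x => v x ^ 2 := by simpa using iv 0 (by norm_num)
  have sh : Integrable fun x => h x ^ 2 := by simpa using ih 0 (by norm_num)
  have ju : Integrable (gdot u u) := by
    simpa only [norm_iteratedFDeriv_one_sq] using iu 1 (by norm_num)
  have jv : Integrable (gdot v v) := by
    simpa only [norm_iteratedFDeriv_one_sq] using iv 1 (by norm_num)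
  have jh : Integrable (gdot h h) := by
    simpa only [norm_iteratedFDeriv_one_sq] using ih 1 (by norm_num)
  have u1 : ∀ x, 0 < 2 + u x := fun x => by linarith [(abs_le.1 (bu x)).1]
  obtain ⟨q, hq⟩ : ∃ q : E3 → ℝ, q = fun x => (2 + u x)⁻¹ := ⟨_, rfl⟩
  have hqe : ∀ x, q x * (2 + u x) = 1 := fun x => by
    rw [hq]; exact inv_mul_cancel₀ (u1 x).ne'
  have q0 : ∀ x, 0 ≤ q x := fun x => by rw [hq]; exact (inv_pos.2 (u1 x)).le
  have q1 : ∀ x, q x ≤ 1 := fun x => by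
    nlinarith [hqe x, q0 x, (abs_le.1 (bu x)).1]
  have qa : ∀ x, |q x| ≤ 1 := fun x => by rw [abs_of_nonneg (q0 x)]; exact q1 x
  have hqc : ContDiff ℝ 2 q := by
    rw [hq]; exact (contDiff_const.add hu).inv fun x => (u1 x).ne'
  have cq := hqc.continuous
  have du : ∀ x, HasFDerivAt u (fderiv ℝ u x) x := fun x =>
    (hu.differentiable (by norm_num) x).hasFDerivAt
  have dv : ∀ x, HasFDerivAt v (fderiv ℝ v x) x := fun x =>
    (hv.differentiable (by norm_num) x).hasFDerivAt
  have dh : ∀ x, HasFDerivAt h (fderiv ℝ h x) x := fun x =>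
    (hh.differentiable (by norm_num) x).hasFDerivAt
  have dq : ∀ x, HasFDerivAt q (-(q x ^ 2) • fderiv ℝ u x) x := fun x => by
    rw [hq]
    exact ((hasDerivAt_inv (u1 x).ne').comp_hasFDerivAt x ((du x).const_add 2)).congr_fderiv
      (by simp)
  have hu1 := hu.of_le (m := 1) (by norm_num)
  have hv1 := hv.of_le (m := 1) (by norm_num)
  have hh1 := hh.of_le (m := 1) (by norm_num)
  have hq1 := hqc.of_le (m := 1) (by norm_num)
  have au : ∀ x, |u x| ≤ 1 := fun x => (bu x).trans (by linarith)
  have av : ∀ x, |v x| ≤ 1 := fun x => (bv x).trans (by linarith)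
  have ah : ∀ x, |h x| ≤ 1 := fun x => (bh x).trans (by linarith)
  have a1h : ∀ x, |1 + h x| ≤ 2 := fun x => by
    have := abs_le.1 (ah x); rw [abs_le]; constructor <;> linarith
  have aq2 : ∀ x, |q x ^ 2| ≤ 1 := fun x => by
    rw [abs_pow]; exact pow_le_one₀ (abs_nonneg _) (qa x)
  have a1h2 : ∀ x, |(1 + h x) ^ 2| ≤ 4 := fun x => by
    rw [abs_pow]; nlinarith [a1h x, abs_nonneg (1 + h x)]
  have Z1 := integral_mul_lap_of_hasFDerivAt (F := fun x => u x * (1 + h x)) (f := u) (h := h)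
    (g := u) (A := fun x => 1 + h x) (B := u) (C := 20) (hu1.mul (contDiff_const.add hh1)) hu
    (fun x => ((du x).mul ((dh x).const_add 1)).congr_fderiv (by ext y; simp; ring))
    (fun x => (a1h x).trans (by norm_num)) (fun x => (au x).trans (by norm_num))
    (integrable_sq_mul_of_abs_le (continuous_const.add ch) cu a1h su) ju jh ju (iu 2 le_rfl)
  have Z2 := integral_mul_lap_of_hasFDerivAt (F := fun x => u x * (2 + u x)) (f := u) (h := h)
    (g := h) (A := fun x => 2 + 2 * u x) (B := fun _ => 0) (C := 20)
    (hu1.mul (contDiff_const.add hu1)) hh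
    (fun x => ((du x).mul ((du x).const_add 2)).congr_fderiv (by ext y; simp; ring))
    (fun x => by have := abs_le.1 (au x); rw [abs_le]; constructor <;> linarith)
    (fun x => by norm_num)
    (integrable_sq_mul_of_abs_le (C := 3) (continuous_const.add cu) cu
      (fun x => by have := abs_le.1 (au x); rw [abs_le]; constructor <;> linarith) su)
    ju jh jh (ih 2 le_rfl)
  have Z3 := integral_mul_lap_of_hasFDerivAt (F := fun x => v x * (1 + h x)) (f := v) (h := h)
    (g := v) (A := fun x => 1 + h x) (B := v) (C := 20) (hv1.mul (contDiff_const.add hh1)) hv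
    (fun x => ((dv x).mul ((dh x).const_add 1)).congr_fderiv (by ext y; simp; ring))
    (fun x => (a1h x).trans (by norm_num)) (fun x => (av x).trans (by norm_num))
    (integrable_sq_mul_of_abs_le (continuous_const.add ch) cv a1h sv) jv jh jv (iv 2 le_rfl)
  have Z4 := integral_mul_lap_of_hasFDerivAt (F := fun x => v x * v x) (f := v) (h := h)
    (g := h) (A := fun x => 2 * v x) (B := fun _ => 0) (C := 20) (hv1.mul hv1) hh
    (fun x => ((dv x).mul (dv x)).congr_fderiv (by ext y; simp; ring))
    (fun x => by have := abs_le.1 (av x); rw [abs_le]; constructor <;> linarith)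
    (fun x => by norm_num)
    (integrable_sq_mul_of_abs_le cv cv av sv) jv jh jh (ih 2 le_rfl)
  have Z5 := integral_mul_lap_of_hasFDerivAt (F := fun x => h x * (2 * (1 + h x + q x)))
    (f := u) (h := h) (g := h) (A := fun x => -2 * (h x * q x ^ 2))
    (B := fun x => 2 * (1 + 2 * h x + q x)) (C := 20)
    (hh1.mul (contDiff_const.mul ((contDiff_const.add hh1).add hq1))) hh
    (fun x => ((dh x).mul ((((dh x).const_add 1).add (dq x)).const_mul 2)).congr_fderiv
      (by ext y; simp; ring))
    (fun x => (abs_mul_le_mul_of_le (by norm_num : |(-2 : ℝ)| ≤ 2)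
      (abs_mul_le_mul_of_le (ah x) (aq2 x))).trans (by norm_num))
    (fun x => by
      have := abs_le.1 (ah x); have := abs_le.1 (qa x)
      rw [abs_le]; constructor <;> linarith)
    (integrable_sq_mul_of_abs_le (C := 6)
      (continuous_const.mul ((continuous_const.add ch).add cq)) ch
      (fun x => by
        have := abs_le.1 (ah x); have := abs_le.1 (qa x)
        rw [abs_le]; constructor <;> linarith) sh)
    ju jh jh (ih 2 le_rfl)
  have Z6 := integral_mul_lap_of_hasFDerivAt (F := fun x => h x * (2 * ((1 + h x) ^ 2 * q x)))
    (f := u) (h := h) (g := u) (A := fun x => -2 * (h x * ((1 + h x) ^ 2 * q x ^ 2)))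
    (B := fun x => 2 * ((1 + h x) ^ 2 * q x) + 4 * (h x * ((1 + h x) * q x))) (C := 20)
    (hh1.mul (contDiff_const.mul (((contDiff_const.add hh1).pow 2).mul hq1))) hu
    (fun x => ((dh x).mul (((((dh x).const_add 1).pow 2).mul (dq x)).const_mul 2)).congr_fderiv
      (by ext y; simp; ring))
    (fun x => (abs_mul_le_mul_of_le (by norm_num : |(-2 : ℝ)| ≤ 2)
      (abs_mul_le_mul_of_le (ah x) (abs_mul_le_mul_of_le (a1h2 x) (aq2 x)))).trans (by norm_num))
    (fun x => (abs_add_le _ _).trans ((add_le_add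
      (abs_mul_le_mul_of_le (abs_two (α := ℝ)).le (abs_mul_le_mul_of_le (a1h2 x) (qa x)))
      (abs_mul_le_mul_of_le (by norm_num : |(4 : ℝ)| ≤ 4)
        (abs_mul_le_mul_of_le (ah x) (abs_mul_le_mul_of_le (a1h x) (qa x))))).trans
      (by norm_num)))
    (integrable_sq_mul_of_abs_le
      (continuous_const.mul (((continuous_const.add ch).pow 2).mul cq)) ch
      (fun x => abs_mul_le_mul_of_le (abs_two (α := ℝ)).le
        (abs_mul_le_mul_of_le (a1h2 x) (qa x))) sh)
    ju jh ju (iu 2 le_rfl)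
  have Z := integral_add_eq_zero (integral_add_eq_zero (integral_add_eq_zero
    (integral_add_eq_zero (integral_add_eq_zero Z1 Z2) Z3) Z4) Z5) Z6
  have iR : Integrable fun x => gdot u u x + gdot v v x + gdot h h x + v x ^ 2 :=
    ((ju.add jv).add jh).add sv
  have iR' : Integrable fun x => gdot u u x + gdot v v x + gdot h h x + v x ^ 2 + gdot f f x :=
    iR.add jf
  rw [← sub_zero (∫ x, _), ← Z.2, ← integral_sub iX Z.1]
  refine (integral_mono (iX.sub Z.1)
    ((iR.const_mul (-(1 / 8))).add (iR'.const_mul (60 * (c + 1) * m))) fun x => ?_).trans_eq ?_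
  · have hden := energy_density_le (lu := lap u x) (lv := lap v x) (lh := lap h x) hc hm (bu x)
      (bv x) (bh x) (hqe x) (gdot_self_nonneg u x) (gdot_self_nonneg v x) (gdot_self_nonneg h x)
      (gdot_self_nonneg f x) (abs_gdot_le u h x) (abs_gdot_le v h x) (abs_gdot_le u f x)
      (abs_gdot_le v f x) (abs_gdot_le h f x) (gdot_weighted u h x)
    have d1 : ∀ r, r / (2 + u x) = r * q x := fun r => by rw [hq, div_eq_mul_inv]
    have d2 : ∀ r, r / (2 * (2 + u x)) = r * q x / 2 := fun r => by
      rw [mul_comm, ← div_div, d1]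
    simp only [Pi.add_apply, Pi.sub_apply, eu, ev, eh, d1, d2, gdot_comm h u x, gdot_comm h v x]
    refine (le_of_eq ?_).trans hden
    ring
  · have e1 : (∫ x, (-(1 / 8) * (gdot u u x + gdot v v x + gdot h h x + v x ^ 2)
        + 60 * (c + 1) * m * (gdot u u x + gdot v v x + gdot h h x + v x ^ 2 + gdot f f x)))
        = -(1 / 8) * (∫ x, (gdot u u x + gdot v v x + gdot h h x + v x ^ 2))
        + 60 * (c + 1) * m
          * ∫ x, (gdot u u x + gdot v v x + gdot h h x + v x ^ 2 + gdot f f x) := by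
      rw [integral_add (iR.const_mul _) (iR'.const_mul _), integral_const_mul, integral_const_mul]
    have iuv : Integrable fun x => gdot u u x + gdot v v x := ju.add jv
    have iuvh : Integrable fun x => gdot u u x + gdot v v x + gdot h h x := iuv.add jh
    refine e1.trans ?_
    rw [integral_add iR jf, integral_add iuvh sv, integral_add iuv jh, integral_add ju jv,
      ← Dsq_one_eq, ← Dsq_one_eq, ← Dsq_one_eq, ← Dsq_one_eq, ← Dsq_zero_eq]

lemma integral_majorant_le {N : ℝ} {u v h f : E3 → ℝ} (hN : 0 ≤ N)
    (hu : ContDiff ℝ 2 u) (hv : ContDiff ℝ 2 v) (hh : ContDiff ℝ 2 h)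
    (iu : ∀ k ≤ 2, Integrable fun x => ‖iteratedFDeriv ℝ k u x‖ ^ 2)
    (iv : ∀ k ≤ 2, Integrable fun x => ‖iteratedFDeriv ℝ k v x‖ ^ 2)
    (ih : ∀ k ≤ 2, Integrable fun x => ‖iteratedFDeriv ℝ k h x‖ ^ 2)
    (jf : Integrable (gdot f f))
    (Du : ∀ k ≤ 2, Dsq k u ≤ 1) (Dv : ∀ k ≤ 2, Dsq k v ≤ 1) (Dh : ∀ k ≤ 2, Dsq k h ≤ 1)
    (Df : Dsq 1 f ≤ 1) :
    (Integrable (fun x => (N * (|lap u x| + |lap v x| + |lap h x| + |v x|)) ^ 2) ∧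
      ∫ x, (N * (|lap u x| + |lap v x| + |lap h x| + |v x|)) ^ 2 ≤ 112 * N ^ 2) ∧
    (Integrable (fun x => N * (gdot u u x + gdot v v x + gdot h h x + gdot f f x
        + u x ^ 2 + v x ^ 2)) ∧
      ∫ x, N * (gdot u u x + gdot v v x + gdot h h x + gdot f f x + u x ^ 2 + v x ^ 2)
        ≤ 6 * N) := by
  have su : Integrable fun x => u x ^ 2 := by simpa using iu 0 (by norm_num)
  have sv : Integrable fun x => v x ^ 2 := by simpa using iv 0 (by norm_num)
  have ju : Integrable (gdot u u) := by
    simpa only [norm_iteratedFDeriv_one_sq] using iu 1 (by norm_num)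
  have jv : Integrable (gdot v v) := by
    simpa only [norm_iteratedFDeriv_one_sq] using iv 1 (by norm_num)
  have jh : Integrable (gdot h h) := by
    simpa only [norm_iteratedFDeriv_one_sq] using ih 1 (by norm_num)
  constructor
  · have cc : Continuous fun x => (N * (|lap u x| + |lap v x| + |lap h x| + |v x|)) ^ 2 := by
      have := continuous_lap hu
      have := continuous_lap hv
      have := continuous_lap hh
      have := hv.continuous
      fun_prop
    have i1 : Integrable fun x => ‖iteratedFDeriv ℝ 2 u x‖ ^ 2 + ‖iteratedFDeriv ℝ 2 v x‖ ^ 2 :=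
      (iu 2 le_rfl).add (iv 2 le_rfl)
    have i2 : Integrable fun x => ‖iteratedFDeriv ℝ 2 u x‖ ^ 2 + ‖iteratedFDeriv ℝ 2 v x‖ ^ 2
        + ‖iteratedFDeriv ℝ 2 h x‖ ^ 2 := i1.add (ih 2 le_rfl)
    have i3 : Integrable fun x => 4 * N ^ 2 * (9 * (‖iteratedFDeriv ℝ 2 u x‖ ^ 2
        + ‖iteratedFDeriv ℝ 2 v x‖ ^ 2 + ‖iteratedFDeriv ℝ 2 h x‖ ^ 2) + v x ^ 2) :=
      ((i2.const_mul 9).add sv).const_mul _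
    have hle : ∀ x, (N * (|lap u x| + |lap v x| + |lap h x| + |v x|)) ^ 2
        ≤ 4 * N ^ 2 * (9 * (‖iteratedFDeriv ℝ 2 u x‖ ^ 2
        + ‖iteratedFDeriv ℝ 2 v x‖ ^ 2 + ‖iteratedFDeriv ℝ 2 h x‖ ^ 2) + v x ^ 2) := fun x => by
      have h1 := sq_lap_le hu x
      have h2 := sq_lap_le hv x
      have h3 := sq_lap_le hh x
      rw [← sq_abs] at h1 h2 h3
      have h4 := sq_abs (v x)
      have : (|lap u x| + |lap v x| + |lap h x| + |v x|) ^ 2 ≤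
          4 * (9 * (‖iteratedFDeriv ℝ 2 u x‖ ^ 2 + ‖iteratedFDeriv ℝ 2 v x‖ ^ 2
            + ‖iteratedFDeriv ℝ 2 h x‖ ^ 2) + v x ^ 2) := by
        nlinarith [sq_nonneg (|lap u x| - |lap v x|), sq_nonneg (|lap u x| - |lap h x|),
          sq_nonneg (|lap u x| - |v x|), sq_nonneg (|lap v x| - |lap h x|),
          sq_nonneg (|lap v x| - |v x|), sq_nonneg (|lap h x| - |v x|)]
      rw [mul_pow]
      nlinarith [mul_le_mul_of_nonneg_left this (sq_nonneg N)]
    have i0 := integrable_of_abs_le cc i3 fun x => by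
      rw [abs_of_nonneg (sq_nonneg _)]; exact hle x
    refine ⟨i0, (integral_mono i0 i3 hle).trans ?_⟩
    rw [integral_const_mul, integral_add (i2.const_mul 9) sv, integral_const_mul,
      integral_add i1 (ih 2 le_rfl), integral_add (iu 2 le_rfl) (iv 2 le_rfl), ← Dsq_zero_eq v]
    have e : (∫ x, ‖iteratedFDeriv ℝ 2 u x‖ ^ 2) + (∫ x, ‖iteratedFDeriv ℝ 2 v x‖ ^ 2)
        + (∫ x, ‖iteratedFDeriv ℝ 2 h x‖ ^ 2) ≤ 3 := by
      have h1 := Du 2 le_rfl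
      have h2 := Dv 2 le_rfl
      have h3 := Dh 2 le_rfl
      simp only [Dsq] at h1 h2 h3
      linarith
    have h4 := Dv 0 (by norm_num)
    nlinarith [sq_nonneg N]
  · have i1 : Integrable fun x => gdot u u x + gdot v v x := ju.add jv
    have i2 : Integrable fun x => gdot u u x + gdot v v x + gdot h h x := i1.add jh
    have i3 : Integrable fun x => gdot u u x + gdot v v x + gdot h h x + gdot f f x := i2.add jf
    have i4 : Integrable fun x => gdot u u x + gdot v v x + gdot h h x + gdot f f x + u x ^ 2 :=
      i3.add su
    refine ⟨(i4.add sv).const_mul N, ?_⟩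
    rw [integral_const_mul, integral_add i4 sv, integral_add i3 su, integral_add i2 jf,
      integral_add i1 jh, integral_add ju jv, ← Dsq_one_eq, ← Dsq_one_eq, ← Dsq_one_eq,
      ← Dsq_one_eq, ← Dsq_zero_eq, ← Dsq_zero_eq, mul_comm 6]
    refine mul_le_mul_of_nonneg_left ?_ hN
    linarith [Du 0 (by norm_num), Du 1 (by norm_num), Dv 0 (by norm_num), Dv 1 (by norm_num),
      Dh 1 (by norm_num)]

lemma Dsq_le_H2sq (f : E3 → ℝ) {k : ℕ} (hk : k ≤ 2) : Dsq k f ≤ H2sq f := by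
  have h0 := Dsq_nonneg 0 f
  have h1 := Dsq_nonneg 1 f
  have h2 := Dsq_nonneg 2 f
  simp only [H2sq]
  interval_cases k <;> linarith

/-- **Lemma (`L²` estimate).** There exist positive constants `δ*, C₁, C₂` such
that: if `(ũ, v, θ̃, φ)` is a solution of the reformulated PNPF system on
`[0, T]` with `‖(ũ, v, θ̃)(t)‖_{H²} + ‖∇φ(t)‖_{L²} ≤ δ ≤ δ*` for all
`t ∈ [0, T]`, then for all `t ∈ (0, T)`:
`½ d/dt (‖(ũ,v)‖²_{L²} + 2c‖θ̃‖²_{L²}) + C₁‖∇(ũ,v,θ̃)‖²_{L²} + C₁‖v‖²_{L²}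
  ≤ C₂ δ ‖∇φ‖²_{L²}`. -/
theorem lem_L2_estimate (c : ℝ) (hc : 1 < c) :
    ∃ δstar > (0 : ℝ), ∃ C₁ > (0 : ℝ), ∃ C₂ > (0 : ℝ),
      ∀ (T δ : ℝ) (u v θ φ : ℝ → E3 → ℝ),
        IsRefSol c T u v θ φ →
        δ ≤ δstar →
        (∀ t ∈ Set.Icc (0 : ℝ) T,
          Real.sqrt (H2sq (u t) + H2sq (v t) + H2sq (θ t))
            + Real.sqrt (Dsq 1 (φ t)) ≤ δ) →
        ∀ t ∈ Set.Ioo (0 : ℝ) T,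
          (1 / 2) * deriv (fun s =>
              Dsq 0 (u s) + Dsq 0 (v s) + 2 * c * Dsq 0 (θ s)) t
            + C₁ * (Dsq 1 (u t) + Dsq 1 (v t) + Dsq 1 (θ t))
            + C₁ * Dsq 0 (v t)
            ≤ C₂ * δ * Dsq 1 (φ t) := by
  obtain ⟨K, hK, hsob⟩ := exists_abs_le_of_H2
  refine ⟨1 / (960 * (c + 1) * (3 * K) + 1), by positivity, 1 / 16, by norm_num,
    60 * (c + 1) * (3 * K), by positivity, ?_⟩
  rintro T δ u v θ φ ⟨Su, Sv, Sθ, Sφ, -, -, hInt, hdec, equ, eqv, eqθ⟩ hδ hsmall t ht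
  have hP : 0 < 960 * (c + 1) * (3 * K) := by positivity
  have hδ0 : 0 ≤ δ := le_trans (by positivity) (hsmall t (Set.Ioo_subset_Icc_self ht))
  have hδP : δ * (960 * (c + 1) * (3 * K) + 1) ≤ 1 := (le_div_iff₀ (by positivity)).1 hδ
  have hδ1 : δ ≤ 1 := by nlinarith
  have hm1 : 960 * (c + 1) * (3 * K * δ) ≤ 1 := by linarith
  have hm0 : 0 ≤ 3 * K * δ := by positivity
  have hm : 3 * K * δ ≤ 1 / 2 := by nlinarith
  have hX : ∀ s ∈ Set.Icc 0 T, H2sq (u s) + H2sq (v s) + H2sq (θ s) ≤ δ ^ 2 := fun s hs =>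
    (Real.sqrt_le_left hδ0).1 (by linarith [hsmall s hs, Real.sqrt_nonneg (Dsq 1 (φ s))])
  have hφ1 : ∀ s ∈ Set.Icc 0 T, Dsq 1 (φ s) ≤ δ ^ 2 := fun s hs =>
    (Real.sqrt_le_left hδ0).1 (by
      linarith [hsmall s hs, Real.sqrt_nonneg (H2sq (u s) + H2sq (v s) + H2sq (θ s))])
  have H0 : ∀ f, 0 ≤ H2sq f := fun f => (Dsq_nonneg 0 f).trans (Dsq_le_H2sq f (by norm_num))
  have Du : ∀ s ∈ Set.Icc 0 T, ∀ k ≤ 2, Dsq k (u s) ≤ δ ^ 2 := fun s hs k hk => by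
    linarith [Dsq_le_H2sq (u s) hk, hX s hs, H0 (v s), H0 (θ s)]
  have Dv : ∀ s ∈ Set.Icc 0 T, ∀ k ≤ 2, Dsq k (v s) ≤ δ ^ 2 := fun s hs k hk => by
    linarith [Dsq_le_H2sq (v s) hk, hX s hs, H0 (u s), H0 (θ s)]
  have Dθ : ∀ s ∈ Set.Icc 0 T, ∀ k ≤ 2, Dsq k (θ s) ≤ δ ^ 2 := fun s hs k hk => by
    linarith [Dsq_le_H2sq (θ s) hk, hX s hs, H0 (u s), H0 (v s)]
  have hδ2 : δ ^ 2 ≤ 1 := pow_le_one₀ hδ0 hδ1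
  have iu : ∀ s ∈ Set.Icc 0 T, ∀ k ≤ 2, Integrable fun x => ‖iteratedFDeriv ℝ k (u s) x‖ ^ 2 :=
    fun s hs k hk => (hInt s hs k (hk.trans (by norm_num))).1
  have iv : ∀ s ∈ Set.Icc 0 T, ∀ k ≤ 2, Integrable fun x => ‖iteratedFDeriv ℝ k (v s) x‖ ^ 2 :=
    fun s hs k hk => (hInt s hs k (hk.trans (by norm_num))).2.1
  have iθ : ∀ s ∈ Set.Icc 0 T, ∀ k ≤ 2, Integrable fun x => ‖iteratedFDeriv ℝ k (θ s) x‖ ^ 2 :=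
    fun s hs k hk => (hInt s hs k (hk.trans (by norm_num))).2.2.1
  have jφ : ∀ s ∈ Set.Icc 0 T, Integrable (gdot (φ s) (φ s)) := fun s hs =>
    (hInt s hs 0 (by norm_num)).2.2.2.congr
      (Eventually.of_forall fun x => norm_iteratedFDeriv_one_sq (φ s) x)
  have sup : ∀ w : E3 → ℝ, ContDiff ℝ 2 w →
      (∀ k ≤ 2, Integrable fun x => ‖iteratedFDeriv ℝ k w x‖ ^ 2) →
      (∀ k ≤ 2, Dsq k w ≤ δ ^ 2) → ∀ x, |w x| ≤ 3 * K * δ := fun w hw hi hD x => by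
    have hs : ∀ k ≤ 2, √(Dsq k w) ≤ δ := fun k hk => (Real.sqrt_le_left hδ0).2 (hD k hk)
    have h0 := hsob w hw hi 1 one_pos x
    have : √(Dsq 0 w) + √(Dsq 1 w) + √(Dsq 2 w) ≤ 3 * δ := by
      linarith [hs 0 (by norm_num), hs 1 (by norm_num), hs 2 le_rfl]
    have := mul_le_mul_of_nonneg_left this hK.le
    simp only [one_pow, div_one, one_mul] at h0
    linarith
  have Cu : ∀ s ∈ Set.Icc 0 T, ContDiff ℝ 2 (u s) := fun s hs => contDiff_slice Su hs
  have Cv : ∀ s ∈ Set.Icc 0 T, ContDiff ℝ 2 (v s) := fun s hs => contDiff_slice Sv hs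
  have Cθ : ∀ s ∈ Set.Icc 0 T, ContDiff ℝ 2 (θ s) := fun s hs => contDiff_slice Sθ hs
  have bu : ∀ s ∈ Set.Icc 0 T, ∀ x, |u s x| ≤ 3 * K * δ := fun s hs =>
    sup _ (Cu s hs) (iu s hs) (Du s hs)
  have bv : ∀ s ∈ Set.Icc 0 T, ∀ x, |v s x| ≤ 3 * K * δ := fun s hs =>
    sup _ (Cv s hs) (iv s hs) (Dv s hs)
  have bθ : ∀ s ∈ Set.Icc 0 T, ∀ x, |θ s x| ≤ 3 * K * δ := fun s hs =>
    sup _ (Cθ s hs) (iθ s hs) (Dθ s hs)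
  obtain ⟨N, hN⟩ : ∃ N, N = 20 * (c + 1) := ⟨_, rfl⟩
  have hN0 : 0 ≤ N := by rw [hN]; linarith
  have hder : ∀ s ∈ Set.Icc 0 T, ∀ x,
      |deriv (fun r => u r x) s| ≤ N * (|lap (u s) x| + |lap (v s) x| + |lap (θ s) x| + |v s x|)
        + N * (gdot (u s) (u s) x + gdot (v s) (v s) x + gdot (θ s) (θ s) x + gdot (φ s) (φ s) x
          + u s x ^ 2 + v s x ^ 2) ∧
      |deriv (fun r => v r x) s| ≤ N * (|lap (u s) x| + |lap (v s) x| + |lap (θ s) x| + |v s x|)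
        + N * (gdot (u s) (u s) x + gdot (v s) (v s) x + gdot (θ s) (θ s) x + gdot (φ s) (φ s) x
          + u s x ^ 2 + v s x ^ 2) ∧
      |deriv (fun r => θ r x) s| ≤ N * (|lap (u s) x| + |lap (v s) x| + |lap (θ s) x| + |v s x|)
        + N * (gdot (u s) (u s) x + gdot (v s) (v s) x + gdot (θ s) (θ s) x + gdot (φ s) (φ s) x
          + u s x ^ 2 + v s x ^ 2) := fun s hs x => by
    have hpos : 0 < 2 + u s x := by linarith [(abs_le.1 (bu s hs x)).1]
    obtain ⟨h1, h2, h3⟩ := abs_rhs_le (lu := lap (u s) x) (lv := lap (v s) x)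
      (lh := lap (θ s) x) hc ((bu s hs x).trans hm) ((bv s hs x).trans hm)
      ((bθ s hs x).trans hm) (inv_mul_cancel₀ hpos.ne') (gdot_self_nonneg (u s) x)
      (gdot_self_nonneg (v s) x) (gdot_self_nonneg (θ s) x) (gdot_self_nonneg (φ s) x)
      (abs_gdot_le (u s) (θ s) x) (abs_gdot_le (v s) (θ s) x) (abs_gdot_le (u s) (φ s) x)
      (abs_gdot_le (v s) (φ s) x) (abs_gdot_le (θ s) (φ s) x)
    have d1 : ∀ r, r / (2 + u s x) = r * (2 + u s x)⁻¹ := fun r => div_eq_mul_inv _ _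
    have d2 : ∀ r, r / (2 * (2 + u s x)) = r * (2 + u s x)⁻¹ / 2 := fun r => by
      rw [mul_comm, ← div_div, d1]
    have h4 := eqθ s hs x
    simp only [d1, d2] at h4
    rw [← hN] at h1 h2 h3
    rw [← h4] at h3
    rw [equ s hs x, eqv s hs x, gdot_comm (θ s) (u s) x, gdot_comm (θ s) (v s) x]
    refine ⟨h1, h2, le_trans ?_ h3⟩
    rw [abs_mul, abs_of_pos (by linarith : 0 < c)]
    exact le_mul_of_one_le_left (abs_nonneg _) hc.le
  have maj := fun s (hs : s ∈ Set.Icc 0 T) =>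
    integral_majorant_le hN0 (Cu s hs) (Cv s hs) (Cθ s hs) (iu s hs) (iv s hs) (iθ s hs) (jφ s hs)
      (fun k hk => (Du s hs k hk).trans hδ2) (fun k hk => (Dv s hs k hk).trans hδ2)
      (fun k hk => (Dθ s hs k hk).trans hδ2) ((hφ1 s hs).trans hδ2)
  have hI : ∀ {s}, s ∈ Set.Ioo 0 T → s ∈ Set.Icc 0 T := fun hs => Set.Ioo_subset_Icc_self hs
  have htI := hI ht
  have hM1 : 112 * N ^ 2 ≤ 112 * N ^ 2 + 6 * N + 1 := by linarith
  have hM2 : 6 * N ≤ 112 * N ^ 2 + 6 * N + 1 := by nlinarith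
  have hM3 : 1 ≤ 112 * N ^ 2 + 6 * N + 1 := by nlinarith
  have diff : ∀ w : ℝ → E3 → ℝ,
      ContDiffOn ℝ (⊤ : ℕ∞) (fun q : ℝ × E3 => w q.1 q.2) (Set.Icc 0 T ×ˢ Set.univ) →
      (∀ s ∈ Set.Icc 0 T, ∀ k ≤ 2, Integrable fun x => ‖iteratedFDeriv ℝ k (w s) x‖ ^ 2) →
      (∀ s ∈ Set.Icc 0 T, ∀ k ≤ 2, Dsq k (w s) ≤ δ ^ 2) →
      (∀ s ∈ Set.Icc 0 T, ∀ x, |deriv (fun r => w r x) s| ≤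
        N * (|lap (u s) x| + |lap (v s) x| + |lap (θ s) x| + |v s x|)
        + N * (gdot (u s) (u s) x + gdot (v s) (v s) x + gdot (θ s) (θ s) x + gdot (φ s) (φ s) x
          + u s x ^ 2 + v s x ^ 2)) →
      Tendsto (w t) (cocompact E3) (𝓝 0) →
      Integrable (fun x => w t x * deriv (fun r => w r x) t) ∧
        HasDerivAt (fun s => Dsq 0 (w s)) (2 * ∫ x, w t x * deriv (fun r => w r x) t) t := by
    intro w Sw iw Dw hw hdw
    obtain ⟨r1, r2, r3⟩ := continuousOn_and_hasDerivAt_of_contDiffOn Sw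
    refine hasDerivAt_Dsq_zero (w := w) (w' := fun s x => deriv (fun r => w r x) s)
      (M := 112 * N ^ 2 + 6 * N + 1) ht (fun s hs => contDiff_slice Sw (hI hs))
      (fun s hs => iw s (hI hs)) (fun s hs x => ?_)
      (fun s hs => (Dw s (hI hs) 0 (by norm_num)).trans (hδ2.trans hM3))
      (fun s hs => (Dw s (hI hs) 2 le_rfl).trans (hδ2.trans hM3)) r1 r2 r3
      (fun s hs x => mul_nonneg hN0 ?_) (fun s hs => hw s (hI hs))
      (fun s hs => (maj s (hI hs)).1.1) (fun s hs => (maj s (hI hs)).2.1)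
      (fun s hs => (maj s (hI hs)).1.2.trans hM1) (fun s hs => (maj s (hI hs)).2.2.trans hM2) hdw
    · have := sup _ (contDiff_slice Sw (hI hs)) (iw s (hI hs)) (Dw s (hI hs)) x
      linarith
    · have := gdot_self_nonneg (u s) x
      have := gdot_self_nonneg (v s) x
      have := gdot_self_nonneg (θ s) x
      have := gdot_self_nonneg (φ s) x
      positivity
  obtain ⟨xu, eu⟩ := diff u Su iu Du (fun s hs x => (hder s hs x).1) (hdec t htI).1
  obtain ⟨xv, ev⟩ := diff v Sv iv Dv (fun s hs x => (hder s hs x).2.1) (hdec t htI).2.1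
  obtain ⟨xθ, eθ⟩ := diff θ Sθ iθ Dθ (fun s hs x => (hder s hs x).2.2) (hdec t htI).2.2.1
  have xuv : Integrable fun x => u t x * deriv (fun r => u r x) t
      + v t x * deriv (fun r => v r x) t := xu.add xv
  have hθe : ∀ x, 2 * θ t x * (c * deriv (fun r => θ r x) t)
      = 2 * c * (θ t x * deriv (fun r => θ r x) t) := fun x => by ring
  have xθ' : Integrable fun x => 2 * θ t x * (c * deriv (fun r => θ r x) t) := by
    simpa only [hθe] using xθ.const_mul (2 * c)
  have main := integral_energy_le hc hm (Cu t htI) (Cv t htI) (Cθ t htI) (bu t htI) (bv t htI)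
    (bθ t htI) (iu t htI) (iv t htI) (iθ t htI) (jφ t htI) (equ t htI) (eqv t htI) (eqθ t htI)
    (xuv.add xθ')
  rw [integral_add xuv xθ', integral_add xu xv] at main
  simp only [hθe] at main
  rw [integral_const_mul] at main
  have hE : deriv (fun s => Dsq 0 (u s) + Dsq 0 (v s) + 2 * c * Dsq 0 (θ s)) t = _ :=
    ((eu.add ev).add (eθ.const_mul (2 * c))).deriv
  rw [hE]
  have G := mul_le_mul_of_nonneg_right hm1 (add_nonneg (add_nonneg (add_nonneg
    (Dsq_nonneg 1 (u t)) (Dsq_nonneg 1 (v t))) (Dsq_nonneg 1 (θ t))) (Dsq_nonneg 0 (v t)))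
  linarith
end
end

section
/- There exists a constant C > 0 such that: for every smooth compactly supported v : ℝ³ → ℝ with φ(x) = −(1/4π)∫_{ℝ³} v(y)/|x − y| dy (so Δφ = v), every smooth θ̃ : ℝ³ → ℝ with derivatives up to order 3 in L²(ℝ³) and decaying at infinity, and all indices i, j ∈ {1,2,3}: |⟨∂_i∂_j(|∇φ|²), ∂_i∂_j θ̃⟩| ≤ C ‖∇φ‖_{L²} ‖∇²v‖_{L²} ‖∇²θ̃‖_{H¹} + C ‖∇φ‖_{L²}^{1/2} ‖v‖_{L²}^{1/2} ‖∇v‖_{L²} ‖∇³θ̃‖_{L²}. -/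
open MeasureTheory Filter Topology Real

noncomputable section

/-- The sup (`L^∞`) norm `‖f‖_{L^∞}` of a bounded function. -/
def supN (f : E3 → ℝ) : ℝ := ⨆ x : E3, |f x|

/-- The Newtonian potential `φ(x) = -(1/4π) ∫ v(y)/|x-y| dy` (so `Δφ = v`). -/
def newt (v : E3 → ℝ) (x : E3) : ℝ := -(1 / (4 * π)) * ∫ y : E3, v y / ‖x - y‖

variable {f g v w : E3 → ℝ} {i j k : Fin 3}

lemma ContDiff.pd (hf : ContDiff ℝ (⊤ : ℕ∞) f) : ContDiff ℝ (⊤ : ℕ∞) (pd i f) :=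
  (hf.fderiv_right (m := (⊤ : ℕ∞)) (by simp)).clm_apply contDiff_const

lemma HasCompactSupport.pd (hf : HasCompactSupport f) : HasCompactSupport (pd i f) :=
  hf.fderiv_apply ℝ _

lemma pd_comm (hf : ContDiff ℝ (⊤ : ℕ∞) f) : pd i (pd j f) = pd j (pd i f) := by
  have hd : Differentiable ℝ (fderiv ℝ f) :=
    (hf.fderiv_right (m := (⊤ : ℕ∞)) (by simp)).differentiable (by simp)
  funext x
  have h : ∀ a b : Fin 3, pd a (pd b f) x
      = fderiv ℝ (fderiv ℝ f) x (EuclideanSpace.single a 1) (EuclideanSpace.single b 1) := by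
    intro a b
    change fderiv ℝ (fun y => fderiv ℝ f y (EuclideanSpace.single b 1)) x _ = _
    rw [fderiv_clm_apply (hd x) (by fun_prop)]
    simp
  rw [h, h]
  exact (hf.contDiffAt.isSymmSndFDerivAt
    (by simpa using WithTop.coe_le_coe.2 (le_top : (2 : ℕ∞) ≤ ⊤))) _ _

lemma pd_mul (hf : ContDiff ℝ (⊤ : ℕ∞) f) (hg : ContDiff ℝ (⊤ : ℕ∞) g) :
    pd i (fun x => f x * g x) = fun x => pd i f x * g x + f x * pd i g x := by
  funext x
  change fderiv ℝ (fun x => f x * g x) x _ = _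
  rw [fderiv_fun_mul (hf.differentiable (by simp) x) (hg.differentiable (by simp) x)]
  simp [pd]
  ring

lemma pd_sum {ι : Type*} {s : Finset ι} {F : ι → E3 → ℝ}
    (hF : ∀ a, ContDiff ℝ (⊤ : ℕ∞) (F a)) :
    pd i (fun x => ∑ a ∈ s, F a x) = fun x => ∑ a ∈ s, pd i (F a) x := by
  funext x
  change fderiv ℝ (fun x => ∑ a ∈ s, F a x) x _ = _
  rw [fderiv_fun_sum fun a _ => (hF a).differentiable (by simp) x]
  simp [pd]

lemma integral_mul_pd (hf : ContDiff ℝ (⊤ : ℕ∞) f) (hg : ContDiff ℝ (⊤ : ℕ∞) g)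
    (h₁ : Integrable fun x => pd i f x * g x) (h₂ : Integrable fun x => f x * pd i g x)
    (h₃ : Integrable fun x => f x * g x) :
    ∫ x, f x * pd i g x = -∫ x, pd i f x * g x :=
  integral_mul_fderiv_eq_neg_fderiv_mul_of_integrable h₁ h₂ h₃
    (fun x _ => hf.differentiable (by simp) x) (fun x _ => hg.differentiable (by simp) x)

lemma integral_mul_pd_of_memLp (hf : ContDiff ℝ (⊤ : ℕ∞) f) (hg : ContDiff ℝ (⊤ : ℕ∞) g)
    (hf₂ : MemLp f 2) (hf₂' : MemLp (pd i f) 2) (hg₂ : MemLp g 2) (hg₂' : MemLp (pd i g) 2) :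
    ∫ x, f x * pd i g x = -∫ x, pd i f x * g x :=
  integral_mul_pd hf hg (hf₂'.integrable_mul hg₂) (hf₂.integrable_mul hg₂')
    (hf₂.integrable_mul hg₂)

lemma integral_mul_pd_of_hasCompactSupport (hf : ContDiff ℝ (⊤ : ℕ∞) f)
    (hg : ContDiff ℝ (⊤ : ℕ∞) g) (hcf : HasCompactSupport f) :
    ∫ x, f x * pd i g x = -∫ x, pd i f x * g x :=
  integral_mul_pd hf hg
    ((hf.pd.continuous.mul hg.continuous).integrable_of_hasCompactSupport hcf.pd.mul_right)
    ((hf.continuous.mul hg.pd.continuous).integrable_of_hasCompactSupport hcf.mul_right)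
    ((hf.continuous.mul hg.continuous).integrable_of_hasCompactSupport hcf.mul_right)

lemma integral_pd_eq_zero (hf : ContDiff ℝ (⊤ : ℕ∞) f) (hcf : HasCompactSupport f) :
    ∫ x, pd i f x = 0 := by
  have h := integral_mul_pd_of_hasCompactSupport (i := i) hf (contDiff_const (c := (1 : ℝ))) hcf
  simpa [_root_.pd] using h.symm

lemma norm_fderiv_le_sum (x : E3) : ‖fderiv ℝ f x‖ ≤ ∑ l : Fin 3, ‖pd l f x‖ := by
  refine ContinuousLinearMap.opNorm_le_bound _ (by positivity) fun y => ?_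
  have hy : y = ∑ l : Fin 3, y l • EuclideanSpace.single l (1 : ℝ) := by
    ext a; simp [Pi.single_apply]
  conv_lhs => rw [hy]
  rw [map_sum, Finset.sum_mul]
  refine (norm_sum_le _ _).trans (Finset.sum_le_sum fun l _ => ?_)
  rw [map_smul, norm_smul, mul_comm]
  gcongr
  · exact le_rfl
  · exact PiLp.norm_apply_le y l

/-! ### The Newtonian potential of a test function -/

lemma locallyIntegrable_inv_norm : LocallyIntegrable (fun x : E3 => ‖x‖⁻¹) := by
  refine locallyIntegrable_of_norm_le_rpow (C := 1) (α := 1) (by simp) (by norm_num)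
    (Eventually.of_forall fun x => ?_) (by fun_prop)
  simp [Real.rpow_neg_one]

lemma newt_eq_convolution :
    newt v = fun x => -(1 / (4 * π)) *
      convolution v (fun z : E3 => ‖z‖⁻¹) (ContinuousLinearMap.mul ℝ ℝ) volume x := by
  funext x
  simp [newt, convolution_def, div_eq_mul_inv]

lemma integrable_div_norm_sub (hv : Continuous v) (hcv : HasCompactSupport v) (x : E3) :
    Integrable fun y => v y / ‖x - y‖ := by
  have := hcv.convolutionExists_left (ContinuousLinearMap.mul ℝ ℝ) hv
    locallyIntegrable_inv_norm x
  simpa [ConvolutionExistsAt, div_eq_mul_inv] using this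

lemma contDiff_newt (hv : ContDiff ℝ (⊤ : ℕ∞) v) (hcv : HasCompactSupport v) :
    ContDiff ℝ (⊤ : ℕ∞) (newt v) := by
  rw [newt_eq_convolution]
  exact contDiff_const.mul (hcv.contDiff_convolution_left _ hv locallyIntegrable_inv_norm)

lemma pd_newt (hv : ContDiff ℝ (⊤ : ℕ∞) v) (hcv : HasCompactSupport v) :
    pd i (newt v) = newt (pd i v) := by
  funext x
  have h := (hcv.hasFDerivAt_convolution_left (ContinuousLinearMap.mul ℝ ℝ) (hv.of_le (by simp))
    locallyIntegrable_inv_norm x).const_mul (-(1 / (4 * π)))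
  rw [pd, newt_eq_convolution, h.fderiv, newt_eq_convolution]
  have hex := (hcv.fderiv ℝ).convolutionExists_left
    ((ContinuousLinearMap.mul ℝ ℝ).precompL E3 : (E3 →L[ℝ] ℝ) →L[ℝ] ℝ →L[ℝ] E3 →L[ℝ] ℝ)
    (hv.continuous_fderiv (by simp)) locallyIntegrable_inv_norm x
  simp only [smul_apply, smul_eq_mul, convolution_def]
  rw [ContinuousLinearMap.integral_apply hex]
  simp [pd]

lemma newt_sum {ι : Type*} {s : Finset ι} {F : ι → E3 → ℝ}
    (hF : ∀ a, Continuous (F a)) (hcF : ∀ a, HasCompactSupport (F a)) (x : E3) :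
    newt (fun y => ∑ a ∈ s, F a y) x = ∑ a ∈ s, newt (F a) x := by
  simp only [newt, Finset.sum_div, ← Finset.mul_sum]
  rw [integral_finsetSum _ fun a _ => integrable_div_norm_sub (hF a) (hcF a) x]

lemma exists_newt_pd_le (hw : ContDiff ℝ (⊤ : ℕ∞) w) (hcw : HasCompactSupport w) :
    ∃ M : ℝ, ∀ x, |newt (pd i w) x| ≤ M * (1 + ‖x‖ ^ 2)⁻¹ := by
  have hc := (contDiff_newt (hw.pd (i := i)) hcw.pd).continuous
  obtain ⟨R, hR, hsupp⟩ : ∃ R : ℝ, 1 ≤ R ∧ ∀ y, R < ‖y‖ → pd i w y = 0 := by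
    obtain ⟨R, hR⟩ := (hcw.pd (i := i)).isCompact.isBounded.exists_norm_le
    refine ⟨max R 1, le_max_right _ _, fun y hy => image_eq_zero_of_notMem_tsupport fun h => ?_⟩
    exact absurd (hR y h) (not_le.2 ((le_max_left _ _).trans_lt hy))
  obtain ⟨A, hA⟩ := (isCompact_closedBall (0 : E3) (2 * R)).exists_bound_of_continuousOn
    hc.continuousOn
  set I := ∫ y, |pd i w y| with hI
  have hw_int : Integrable fun y => |pd i w y| :=
    ((hw.pd (i := i)).continuous.integrable_of_hasCompactSupport hcw.pd).abs
  have hI0 : 0 ≤ I := integral_nonneg fun y => abs_nonneg _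
  have hA0 : 0 ≤ A := (norm_nonneg _).trans (hA 0 (by simp; linarith))
  refine ⟨A * (1 + (2 * R) ^ 2) + 1 / (4 * π) * (I * (2 * R) * 2), fun x => ?_⟩
  rw [← div_eq_mul_inv, le_div_iff₀ (by positivity)]
  rcases le_or_gt ‖x‖ (2 * R) with hx | hx
  · have h1 := hA x (by simpa using hx)
    rw [Real.norm_eq_abs] at h1
    have : |newt (pd i w) x| * (1 + ‖x‖ ^ 2) ≤ A * (1 + (2 * R) ^ 2) := by gcongr
    have h2 : 0 ≤ 1 / (4 * π) * (I * (2 * R) * 2) := by positivity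
    linarith
  · have hx0 : 0 < ‖x‖ := by linarith
    have key : |∫ y, pd i w y / ‖x - y‖| ≤ I * (2 * R) / ‖x‖ ^ 2 := by
      have h0 : ∫ y, pd i w y / ‖x - y‖ = ∫ y, (pd i w y / ‖x - y‖ - pd i w y * ‖x‖⁻¹) := by
        rw [integral_sub (integrable_div_norm_sub hw.pd.continuous hcw.pd x)
          ((hw.pd.continuous.integrable_of_hasCompactSupport hcw.pd).mul_const _),
          integral_mul_const, integral_pd_eq_zero hw hcw]
        simp
      rw [h0, ← Real.norm_eq_abs, mul_div_assoc, hI, ← integral_mul_const]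
      refine norm_integral_le_of_norm_le (hw_int.mul_const _) (Eventually.of_forall fun y => ?_)
      rcases lt_or_ge R ‖y‖ with hy | hy
      · simp [hsupp y hy]
      · have hxy : ‖x‖ / 2 ≤ ‖x - y‖ := by
          have := norm_sub_norm_le x y
          linarith
        have hxy0 : 0 < ‖x - y‖ := by linarith
        have e : pd i w y / ‖x - y‖ - pd i w y * ‖x‖⁻¹
            = pd i w y * ((‖x‖ - ‖x - y‖) / (‖x‖ * ‖x - y‖)) := by
          field_simp
        rw [e, Real.norm_eq_abs, abs_mul, abs_div, abs_of_pos (mul_pos hx0 hxy0)]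
        have h3 : |‖x‖ - ‖x - y‖| ≤ R := by
          have := abs_norm_sub_norm_le x (x - y)
          rw [sub_sub_cancel] at this
          linarith
        refine mul_le_mul_of_nonneg_left ?_ (abs_nonneg _)
        calc |‖x‖ - ‖x - y‖| / (‖x‖ * ‖x - y‖) ≤ R / (‖x‖ * (‖x‖ / 2)) := by gcongr
          _ = 2 * R / ‖x‖ ^ 2 := by field_simp
    have h1 : |newt (pd i w) x| ≤ 1 / (4 * π) * (I * (2 * R) / ‖x‖ ^ 2) := by
      rw [newt, abs_mul, abs_neg, abs_of_pos (by positivity : 0 < 1 / (4 * π))]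
      gcongr
    have h2 : (1 + ‖x‖ ^ 2) ≤ 2 * ‖x‖ ^ 2 := by nlinarith
    calc |newt (pd i w) x| * (1 + ‖x‖ ^ 2)
        ≤ 1 / (4 * π) * (I * (2 * R) / ‖x‖ ^ 2) * (2 * ‖x‖ ^ 2) := by gcongr
      _ = 1 / (4 * π) * (I * (2 * R) * 2) := by field_simp
      _ ≤ _ := by
        have : 0 ≤ A * (1 + (2 * R) ^ 2) := by positivity
        linarith

lemma exists_abs_newt_pd_le (hw : ContDiff ℝ (⊤ : ℕ∞) w) (hcw : HasCompactSupport w) :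
    ∃ M : ℝ, ∀ x, |newt (pd i w) x| ≤ M := by
  obtain ⟨M, hM⟩ := exists_newt_pd_le (i := i) hw hcw
  have hM0 : 0 ≤ M := by simpa using (abs_nonneg _).trans (hM 0)
  refine ⟨M, fun x => (hM x).trans (mul_le_of_le_one_right hM0 (inv_le_one_of_one_le₀ ?_))⟩
  nlinarith [sq_nonneg ‖x‖]

lemma memLp_newt_pd (hw : ContDiff ℝ (⊤ : ℕ∞) w) (hcw : HasCompactSupport w) :
    MemLp (newt (pd i w)) 2 := by
  obtain ⟨M, hM⟩ := exists_newt_pd_le (i := i) hw hcw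
  have hc := (contDiff_newt (hw.pd (i := i)) hcw.pd).continuous
  have hJ : MemLp (fun x : E3 => M * (1 + ‖x‖ ^ 2)⁻¹) 2 := by
    refine MemLp.const_mul ?_ M
    rw [memLp_two_iff_integrable_sq (by fun_prop)]
    have := integrable_rpow_neg_one_add_norm_sq (E := E3) (μ := volume) (r := 4)
      (by norm_num)
    refine this.congr (Eventually.of_forall fun x => ?_)
    have h0 : (0 : ℝ) < 1 + ‖x‖ ^ 2 := by positivity
    change _ ^ (-4 / 2 : ℝ) = _
    rw [show (-4 / 2 : ℝ) = -((2 : ℕ) : ℝ) by norm_num, Real.rpow_neg h0.le, Real.rpow_natCast,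
      ← inv_pow]
  exact hJ.mono' hc.aestronglyMeasurable (Eventually.of_forall hM)

/-! ### The Laplacian of the Newtonian potential -/

/-- The regularised kernel `(ε² + |x - y|²)^s`, as a function of `y`. -/
def regKernel (x : E3) (ε s : ℝ) (y : E3) : ℝ := (ε ^ 2 + ‖x - y‖ ^ 2) ^ s

section regKernel

variable {x : E3} {ε s : ℝ}

lemma contDiff_regKernel (hε : 0 < ε) : ContDiff ℝ (⊤ : ℕ∞) (regKernel x ε s) := by
  refine ContDiff.rpow_const_of_ne ?_ fun y => by positivity
  exact contDiff_const.add ((contDiff_const.sub contDiff_id).norm_sq ℝ)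

lemma pd_regKernel (hε : 0 < ε) :
    pd i (regKernel x ε s) = fun y => -(2 * s) * ((x i - y i) * regKernel x ε (s - 1) y) := by
  funext y
  have h1 : HasFDerivAt (fun y : E3 => ε ^ 2 + ‖x - y‖ ^ 2) _ y :=
    (((hasFDerivAt_const x y).sub (hasFDerivAt_id y)).norm_sq).const_add (ε ^ 2)
  have h2 := h1.rpow_const (p := s) (Or.inl (by positivity))
  rw [pd]
  change fderiv ℝ (fun y : E3 => (ε ^ 2 + ‖x - y‖ ^ 2) ^ s) y _ = _
  rw [h2.fderiv]
  simp [regKernel, EuclideanSpace.inner_single_right]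
  ring

lemma lap_regKernel (hε : 0 < ε) (y : E3) :
    lap (regKernel x ε (-1 / 2)) y = -3 * (ε ^ 2 * regKernel x ε (-5 / 2) y) := by
  have hlin : ∀ a : Fin 3, ContDiff ℝ (⊤ : ℕ∞) fun y : E3 => x a - y a := fun a => by fun_prop
  have hpd : ∀ a : Fin 3, pd a (fun y : E3 => x a - y a) = fun _ => -1 := by
    intro a
    funext y
    have h : HasFDerivAt (fun y : E3 => x a - y a) _ y :=
      (EuclideanSpace.proj (𝕜 := ℝ) a).hasFDerivAt.const_sub (x a)
    rw [pd, h.fderiv]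
    simp
  have h3 : regKernel x ε (-1 / 2 - 1) y = (ε ^ 2 + ‖x - y‖ ^ 2) * regKernel x ε (-5 / 2) y := by
    have h0 : 0 < ε ^ 2 + ‖x - y‖ ^ 2 := by positivity
    rw [regKernel, regKernel, show (-1 / 2 - 1 : ℝ) = 1 + -5 / 2 by norm_num,
      Real.rpow_add h0, Real.rpow_one]
  have hn : ‖x - y‖ ^ 2 = ∑ a : Fin 3, (x a - y a) ^ 2 := by
    simp [EuclideanSpace.norm_sq_eq]
  have hsecond : ∀ a : Fin 3, pd a (pd a (regKernel x ε (-1 / 2))) y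
      = -regKernel x ε (-1 / 2 - 1) y + 3 * (x a - y a) ^ 2 * regKernel x ε (-5 / 2) y := by
    intro a
    rw [pd_regKernel hε]
    have e : (fun y : E3 => -(2 * (-1 / 2 : ℝ)) * ((x a - y a) * regKernel x ε (-1 / 2 - 1) y))
        = fun y => (x a - y a) * regKernel x ε (-1 / 2 - 1) y := by
      funext y; ring
    rw [e, pd_mul (hlin a) (contDiff_regKernel hε), hpd, pd_regKernel hε,
      show (-1 / 2 - 1 - 1 : ℝ) = -5 / 2 by norm_num]
    ring
  simp only [lap, hsecond, h3, hn, Fin.sum_univ_three]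
  ring

end regKernel

lemma ContDiff.lap (hf : ContDiff ℝ (⊤ : ℕ∞) f) : ContDiff ℝ (⊤ : ℕ∞) (lap f) :=
  ContDiff.sum fun _ _ => hf.pd.pd

lemma HasCompactSupport.lap (hf : HasCompactSupport f) : HasCompactSupport (lap f) := by
  have h : _root_.lap f = fun x => _root_.pd 0 (_root_.pd 0 f) x + _root_.pd 1 (_root_.pd 1 f) x
      + _root_.pd 2 (_root_.pd 2 f) x := by
    funext x; simp [_root_.lap, Fin.sum_univ_three]
  rw [h]
  exact (hf.pd.pd.add hf.pd.pd).add hf.pd.pd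

lemma integral_lap_mul (hf : ContDiff ℝ (⊤ : ℕ∞) f) (hg : ContDiff ℝ (⊤ : ℕ∞) g)
    (hcf : HasCompactSupport f) : ∫ x, lap f x * g x = ∫ x, f x * lap g x := by
  simp only [lap, Finset.sum_mul, Finset.mul_sum]
  have h₁ : ∀ a : Fin 3, Integrable fun x => pd a (pd a f) x * g x := fun a =>
    (hf.pd.pd.continuous.mul hg.continuous).integrable_of_hasCompactSupport hcf.pd.pd.mul_right
  have h₂ : ∀ a : Fin 3, Integrable fun x => f x * pd a (pd a g) x := fun a =>
    (hf.continuous.mul hg.pd.pd.continuous).integrable_of_hasCompactSupport hcf.mul_right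
  rw [integral_finsetSum _ fun a _ => h₁ a, integral_finsetSum _ fun a _ => h₂ a]
  refine Finset.sum_congr rfl fun a _ => ?_
  rw [integral_mul_pd_of_hasCompactSupport hf hg.pd hcf,
    integral_mul_pd_of_hasCompactSupport hf.pd hg hcf.pd, neg_neg]

lemma lap_newt_eq (hv : ContDiff ℝ (⊤ : ℕ∞) v) (hcv : HasCompactSupport v) (x : E3) :
    lap (newt v) x = newt (lap v) x := by
  have h : lap v = fun y => ∑ a : Fin 3, pd a (pd a v) y := rfl
  rw [h, newt_sum (fun a => hv.pd.pd.continuous) (fun a => hcv.pd.pd)]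
  simp only [lap]
  refine Finset.sum_congr rfl fun a _ => ?_
  rw [pd_newt hv hcv, pd_newt hv.pd hcv.pd]

lemma integral_mul_regKernel {ε : ℝ} (hε : 0 < ε) (x : E3) :
    ∫ y, v y * (ε ^ 2 * regKernel x ε (-5 / 2) y)
      = ∫ z, v (x - ε • z) * (1 + ‖z‖ ^ 2) ^ (-5 / 2 : ℝ) := by
  have h1 := integral_sub_left_eq_self
    (fun y => v y * (ε ^ 2 * regKernel x ε (-5 / 2) y)) (volume : Measure E3) x
  have h2 := Measure.integral_comp_smul (volume : Measure E3)
    (fun y => v (x - y) * (ε ^ 2 * regKernel x ε (-5 / 2) (x - y))) ε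
  rw [← h1]
  have h3 : ∀ z : E3, v (x - ε • z) * (ε ^ 2 * regKernel x ε (-5 / 2) (x - ε • z))
      = (ε ^ 3)⁻¹ * (v (x - ε • z) * (1 + ‖z‖ ^ 2) ^ (-5 / 2 : ℝ)) := by
    intro z
    have : regKernel x ε (-5 / 2) (x - ε • z)
        = (ε ^ 5)⁻¹ * (1 + ‖z‖ ^ 2) ^ (-5 / 2 : ℝ) := by
      rw [regKernel, sub_sub_cancel, norm_smul, Real.norm_of_nonneg hε.le, mul_pow,
        show ε ^ 2 + ε ^ 2 * ‖z‖ ^ 2 = ε ^ 2 * (1 + ‖z‖ ^ 2) by ring,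
        Real.mul_rpow (by positivity) (by positivity), ← Real.rpow_natCast ε 2,
        ← Real.rpow_mul hε.le, ← Real.rpow_natCast ε 5, ← Real.rpow_neg hε.le]
      norm_num
    rw [this]
    field_simp
  simp only [h3, integral_const_mul] at h2
  rw [finrank_euclideanSpace_fin, abs_of_pos (by positivity), smul_eq_mul] at h2
  exact (mul_left_cancel₀ (by positivity) h2).symm

/-- Poisson's equation for the Newtonian potential, up to an unspecified universal constant. -/
lemma exists_lap_newt_eq : ∃ c : ℝ, ∀ v : E3 → ℝ, ContDiff ℝ (⊤ : ℕ∞) v →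
    HasCompactSupport v → ∀ x, lap (newt v) x = c * v x := by
  refine ⟨-(1 / (4 * π)) * (-3 * ∫ z : E3, (1 + ‖z‖ ^ 2) ^ (-5 / 2 : ℝ)),
    fun v hv hcv x => ?_⟩
  rw [lap_newt_eq hv hcv, newt, mul_assoc]
  congr 1
  set ε : ℕ → ℝ := fun n => 1 / ((n : ℝ) + 1)
  have hε : ∀ n, 0 < ε n := fun n => by positivity
  have hε0 : Tendsto ε atTop (𝓝 0) := tendsto_one_div_add_atTop_nhds_zero_nat
  have hε2 : Tendsto (fun n => ε n ^ 2) atTop (𝓝 0) := by simpa using hε0.pow 2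
  have hlapc := hv.lap.continuous
  have hkerc : ∀ n s, Continuous (regKernel x (ε n) s) := fun n s =>
    (contDiff_regKernel (hε n)).continuous
  have hne : ∀ᵐ y : E3, y ≠ x := by simp [ae_iff]
  have lim1 : Tendsto (fun n => ∫ y, lap v y * regKernel x (ε n) (-1 / 2) y) atTop
      (𝓝 (∫ y, lap v y / ‖x - y‖)) := by
    refine tendsto_integral_of_dominated_convergence (fun y => ‖lap v y / ‖x - y‖‖)
      (fun n => (hlapc.mul (hkerc n _)).aestronglyMeasurable)
      (integrable_div_norm_sub hlapc hcv.lap x).norm (fun n => ?_) ?_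
    · filter_upwards [hne] with y hy
      have hxy : 0 < ‖x - y‖ := norm_pos_iff.2 (sub_ne_zero.2 hy.symm)
      rw [norm_mul, norm_div, norm_norm, div_eq_mul_inv ‖_‖]
      gcongr
      rw [regKernel, Real.norm_of_nonneg (by positivity)]
      calc (ε n ^ 2 + ‖x - y‖ ^ 2) ^ (-1 / 2 : ℝ) ≤ (‖x - y‖ ^ 2) ^ (-1 / 2 : ℝ) :=
            Real.rpow_le_rpow_of_nonpos (by positivity)
              (le_add_of_nonneg_left (by positivity)) (by norm_num)
        _ = ‖x - y‖⁻¹ := by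
            rw [← Real.rpow_natCast, ← Real.rpow_mul hxy.le, ← Real.rpow_neg_one]
            norm_num
    · filter_upwards [hne] with y hy
      have hxy : 0 < ‖x - y‖ := norm_pos_iff.2 (sub_ne_zero.2 hy.symm)
      rw [div_eq_mul_inv]
      refine tendsto_const_nhds.mul ?_
      have h1 : Tendsto (fun n => ε n ^ 2 + ‖x - y‖ ^ 2) atTop (𝓝 (‖x - y‖ ^ 2)) := by
        simpa using hε2.add_const (‖x - y‖ ^ 2)
      have h2 := h1.rpow_const (p := -1 / 2) (Or.inl (by positivity))
      rwa [show (‖x - y‖ ^ 2) ^ (-1 / 2 : ℝ) = ‖x - y‖⁻¹ by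
        rw [← Real.rpow_natCast, ← Real.rpow_mul hxy.le, ← Real.rpow_neg_one]
        norm_num] at h2
  obtain ⟨B, hB⟩ := hcv.exists_bound_of_continuous hv.continuous
  have hJ : Integrable fun z : E3 => (1 + ‖z‖ ^ 2) ^ (-5 / 2 : ℝ) :=
    integrable_rpow_neg_one_add_norm_sq (by norm_num)
  have lim2 : Tendsto (fun n => ∫ z, v (x - ε n • z) * (1 + ‖z‖ ^ 2) ^ (-5 / 2 : ℝ)) atTop
      (𝓝 (∫ z : E3, v x * (1 + ‖z‖ ^ 2) ^ (-5 / 2 : ℝ))) := by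
    refine tendsto_integral_of_dominated_convergence
      (fun z => B * (1 + ‖z‖ ^ 2) ^ (-5 / 2 : ℝ)) (fun n => ?_) (hJ.const_mul B)
      (fun n => Eventually.of_forall fun z => ?_) (Eventually.of_forall fun z => ?_)
    · exact ((hv.continuous.comp (by fun_prop)).aestronglyMeasurable).mul
        hJ.aestronglyMeasurable
    · rw [norm_mul, Real.norm_of_nonneg (by positivity : 0 ≤ (1 + ‖z‖ ^ 2) ^ (-5 / 2 : ℝ))]
      gcongr
      exact hB _
    · refine Tendsto.mul_const _ ((hv.continuous.tendsto x).comp ?_)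
      simpa using (hε0.smul_const z).const_sub x
  rw [integral_const_mul] at lim2
  have heq : ∀ n, ∫ y, lap v y * regKernel x (ε n) (-1 / 2) y
      = -3 * ∫ z, v (x - ε n • z) * (1 + ‖z‖ ^ 2) ^ (-5 / 2 : ℝ) := by
    intro n
    rw [integral_lap_mul hv (contDiff_regKernel (hε n)) hcv, ← integral_mul_regKernel (hε n),
      ← integral_const_mul]
    refine integral_congr_ae (Eventually.of_forall fun y => ?_)
    simp only [lap_regKernel (hε n)]
    ring
  simp only [heq] at lim1
  rw [tendsto_nhds_unique lim1 (lim2.const_mul (-3))]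
  ring

/-! ### Second-order elliptic estimate -/

lemma memLp_pd_newt (hw : ContDiff ℝ (⊤ : ℕ∞) w) (hcw : HasCompactSupport w) :
    MemLp (pd i (newt w)) 2 := by
  rw [pd_newt hw hcw]
  exact memLp_newt_pd hw hcw

lemma memLp_pd_pd_newt (hw : ContDiff ℝ (⊤ : ℕ∞) w) (hcw : HasCompactSupport w) :
    MemLp (pd i (pd j (newt w))) 2 := by
  rw [pd_newt hw hcw]
  exact memLp_pd_newt hw.pd hcw.pd

lemma memLp_pd_pd_pd_newt (hw : ContDiff ℝ (⊤ : ℕ∞) w) (hcw : HasCompactSupport w) :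
    MemLp (pd i (pd j (pd k (newt w)))) 2 := by
  rw [pd_newt hw hcw]
  exact memLp_pd_pd_newt hw.pd hcw.pd

lemma integral_pd_pd_newt_sq (hw : ContDiff ℝ (⊤ : ℕ∞) w) (hcw : HasCompactSupport w) :
    ∫ x, pd i (pd j (newt w)) x ^ 2
      = ∫ x, pd i (pd i (newt w)) x * pd j (pd j (newt w)) x := by
  have hu := contDiff_newt hw hcw
  simp only [sq]
  rw [integral_mul_pd_of_memLp hu.pd.pd hu.pd (memLp_pd_pd_newt hw hcw)
      (memLp_pd_pd_pd_newt hw hcw) (memLp_pd_newt hw hcw) (memLp_pd_pd_newt hw hcw),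
    integral_mul_pd_of_memLp hu.pd.pd hu.pd (memLp_pd_pd_newt hw hcw)
      (memLp_pd_pd_pd_newt hw hcw) (memLp_pd_newt hw hcw) (memLp_pd_pd_newt hw hcw),
    pd_comm (i := j) (j := i) hu.pd, pd_comm (i := j) (j := i) hu]

lemma sum_integral_pd_pd_newt_sq (hw : ContDiff ℝ (⊤ : ℕ∞) w) (hcw : HasCompactSupport w) :
    ∑ a : Fin 3, ∑ b : Fin 3, ∫ x, pd a (pd b (newt w)) x ^ 2 = ∫ x, lap (newt w) x ^ 2 := by
  simp only [integral_pd_pd_newt_sq hw hcw]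
  have h : ∀ a b : Fin 3, Integrable fun x => pd a (pd a (newt w)) x * pd b (pd b (newt w)) x :=
    fun a b => (memLp_pd_pd_newt hw hcw).integrable_mul (memLp_pd_pd_newt hw hcw)
  have e : ∀ x, lap (newt w) x ^ 2
      = ∑ a : Fin 3, ∑ b : Fin 3, pd a (pd a (newt w)) x * pd b (pd b (newt w)) x := by
    intro x
    rw [sq, lap, Finset.sum_mul_sum]
  simp only [e]
  rw [integral_finsetSum _ fun a _ => integrable_finsetSum _ fun b _ => h a b]
  exact Finset.sum_congr rfl fun a _ => (integral_finsetSum _ fun b _ => h a b).symm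

lemma eLpNorm_two_eq_ofReal_sqrt {F : Type*} [NormedAddCommGroup F] {u : E3 → F}
    (hu : MemLp u 2) : eLpNorm u 2 = ENNReal.ofReal √(∫ x, ‖u x‖ ^ 2) := by
  rw [hu.eLpNorm_eq_integral_rpow_norm (by simp) (by simp), Real.sqrt_eq_rpow]
  simp

lemma exists_eLpNorm_pd_pd_newt_le : ∃ K : NNReal, ∀ w : E3 → ℝ, ContDiff ℝ (⊤ : ℕ∞) w →
    HasCompactSupport w → ∀ i j : Fin 3,
      eLpNorm (pd i (pd j (newt w))) 2 ≤ K * eLpNorm w 2 := by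
  obtain ⟨c, hc⟩ := exists_lap_newt_eq
  refine ⟨‖c‖₊, fun w hw hcw i j => ?_⟩
  have hw2 : MemLp w 2 := hw.continuous.memLp_of_hasCompactSupport hcw
  have hle : ∫ x, pd i (pd j (newt w)) x ^ 2 ≤ ∫ x, ‖c * w x‖ ^ 2 := by
    have h0 : ∀ a b : Fin 3, 0 ≤ ∫ x, pd a (pd b (newt w)) x ^ 2 := fun a b =>
      integral_nonneg fun x => sq_nonneg _
    calc ∫ x, pd i (pd j (newt w)) x ^ 2
        ≤ ∑ b : Fin 3, ∫ x, pd i (pd b (newt w)) x ^ 2 :=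
          Finset.single_le_sum (f := fun b => ∫ x, pd i (pd b (newt w)) x ^ 2)
            (fun b _ => h0 i b) (Finset.mem_univ j)
      _ ≤ ∑ a : Fin 3, ∑ b : Fin 3, ∫ x, pd a (pd b (newt w)) x ^ 2 :=
          Finset.single_le_sum (f := fun a => ∑ b : Fin 3, ∫ x, pd a (pd b (newt w)) x ^ 2)
            (fun a _ => Finset.sum_nonneg fun b _ => h0 a b) (Finset.mem_univ i)
      _ = ∫ x, ‖c * w x‖ ^ 2 := by
          rw [sum_integral_pd_pd_newt_sq hw hcw]
          simp only [hc w hw hcw, Real.norm_eq_abs, sq_abs]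
  have hcw2 : eLpNorm (fun x => c * w x) 2 = ‖c‖₊ * eLpNorm w 2 := eLpNorm_const_smul c w 2 _
  rw [← hcw2, eLpNorm_two_eq_ofReal_sqrt (memLp_pd_pd_newt hw hcw),
    eLpNorm_two_eq_ofReal_sqrt (hw2.const_mul c)]
  refine ENNReal.ofReal_le_ofReal (Real.sqrt_le_sqrt ?_)
  simpa only [Real.norm_eq_abs, sq_abs] using hle

/-! ### Sobolev's inequality without compact support -/

lemma exists_smooth_cutoff : ∃ χ : E3 → ℝ, ContDiff ℝ (⊤ : ℕ∞) χ ∧ HasCompactSupport χ ∧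
    (∀ x, 0 ≤ χ x) ∧ (∀ x, χ x ≤ 1) ∧ χ 0 = 1 := by
  let χ : ContDiffBump (0 : E3) := ⟨1, 2, one_pos, one_lt_two⟩
  exact ⟨χ, χ.contDiff, χ.hasCompactSupport, fun x => χ.nonneg, fun x => χ.le_one,
    χ.one_of_mem_closedBall (by simp [χ])⟩

lemma exists_eLpNorm_six_le_of_hasCompactSupport : ∃ S : NNReal, ∀ f : E3 → ℝ,
    ContDiff ℝ (⊤ : ℕ∞) f → HasCompactSupport f → eLpNorm f 6 ≤ S * eLpNorm (fderiv ℝ f) 2 := by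
  refine ⟨SNormLESNormFDerivOfEqConst ℝ (volume : Measure E3) ((2 : NNReal) : ℝ),
    fun f hf hcf => ?_⟩
  have h := eLpNorm_le_eLpNorm_fderiv_of_eq (volume : Measure E3) (F := ℝ) (p := 2) (p' := 6)
    (hf.of_le (by simp)) hcf (by norm_num) (by simp) (by simp; norm_num)
  simpa only [ENNReal.coe_ofNat] using h

lemma eLpNorm_le_add_const_mul {F G H : Type*} [NormedAddCommGroup F] [NormedAddCommGroup G]
    [NormedAddCommGroup H] {a : E3 → F} {b : E3 → G} {d : E3 → H} {c : ℝ} (hc : 0 ≤ c)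
    (hb : Continuous b) (hd : Continuous d) (h : ∀ x, ‖a x‖ ≤ ‖b x‖ + c * ‖d x‖) :
    eLpNorm a 2 ≤ eLpNorm b 2 + ENNReal.ofReal c * eLpNorm d 2 := by
  have h1 : eLpNorm (fun x => c * ‖d x‖) 2 = ENNReal.ofReal c * eLpNorm d 2 := by
    refine (eLpNorm_const_smul c (fun x => ‖d x‖) 2 _).trans ?_
    rw [eLpNorm_norm, Real.enorm_of_nonneg hc]
  rw [← h1, ← eLpNorm_norm b]
  exact (eLpNorm_mono_real h).trans (eLpNorm_add_le hb.norm.aestronglyMeasurable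
    (continuous_const.mul hd.norm).aestronglyMeasurable one_le_two)

lemma exists_eLpNorm_six_le : ∃ S : NNReal, ∀ f : E3 → ℝ, ContDiff ℝ (⊤ : ℕ∞) f →
    MemLp f 2 → eLpNorm f 6 ≤ S * eLpNorm (fderiv ℝ f) 2 := by
  obtain ⟨S, hS⟩ := exists_eLpNorm_six_le_of_hasCompactSupport
  refine ⟨S, fun f hf hf2 => ?_⟩
  obtain ⟨χ, hχ, hχs, hχ0, hχ1, hχ_zero⟩ := exists_smooth_cutoff
  obtain ⟨M, hM⟩ := (hχs.fderiv ℝ).exists_bound_of_continuous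
    (hχ.continuous_fderiv (by simp))
  have hM0 : 0 ≤ M := (norm_nonneg _).trans (hM 0)
  set ε : ℕ → ℝ := fun n => 1 / ((n : ℝ) + 1)
  have hε : ∀ n, 0 < ε n := fun n => by positivity
  have hε0 : Tendsto ε atTop (𝓝 0) := tendsto_one_div_add_atTop_nhds_zero_nat
  set u : ℕ → E3 → ℝ := fun n x => χ (ε n • x) * f x with hu
  have hχn : ∀ n, ContDiff ℝ (⊤ : ℕ∞) fun x : E3 => χ (ε n • x) := fun n =>
    hχ.comp (contDiff_const_smul (ε n))
  have hun : ∀ n, ContDiff ℝ (⊤ : ℕ∞) (u n) := fun n => (hχn n).mul hf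
  have hucs : ∀ n, HasCompactSupport (u n) := fun n =>
    HasCompactSupport.mul_right
      (hχs.comp_homeomorph (Homeomorph.smulOfNeZero (ε n) (hε n).ne'))
  have hfd : ∀ n x, ‖fderiv ℝ (u n) x‖ ≤ ‖fderiv ℝ f x‖ + ε n * M * ‖f x‖ := by
    intro n x
    have h1 : HasFDerivAt (fun x : E3 => χ (ε n • x)) _ x :=
      HasFDerivAt.comp x (hχ.differentiable (by simp) (ε n • x)).hasFDerivAt
        ((hasFDerivAt_id x).const_smul (ε n))
    have h2 := h1.mul (hf.differentiable (by simp) x).hasFDerivAt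
    rw [show fderiv ℝ (u n) x = _ from h2.fderiv]
    refine (norm_add_le _ _).trans (add_le_add ?_ ?_)
    · rw [norm_smul, Real.norm_of_nonneg (hχ0 _)]
      exact mul_le_of_le_one_left (norm_nonneg _) (hχ1 _)
    · rw [norm_smul, mul_comm]
      gcongr
      refine (ContinuousLinearMap.opNorm_comp_le _ _).trans ?_
      rw [mul_comm]
      gcongr
      · rw [norm_smul, Real.norm_of_nonneg (hε n).le]
        exact mul_le_of_le_one_right (hε n).le ContinuousLinearMap.norm_id_le
      · exact hM _
  have hbound : ∀ n, eLpNorm (u n) 6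
      ≤ S * (eLpNorm (fderiv ℝ f) 2 + ENNReal.ofReal (ε n * M) * eLpNorm f 2) := by
    intro n
    refine (hS _ (hun n) (hucs n)).trans (mul_le_mul_right ?_ _)
    exact eLpNorm_le_add_const_mul (mul_nonneg (hε n).le hM0) (hf.continuous_fderiv (by simp))
      hf.continuous (hfd n)
  have hlim : ∀ x, Tendsto (fun n => u n x) atTop (𝓝 (f x)) := by
    intro x
    have h1 : Tendsto (fun n => χ (ε n • x)) atTop (𝓝 1) := by
      have h2 : Tendsto (fun n => ε n • x) atTop (𝓝 0) := by simpa using hε0.smul_const x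
      rw [← hχ_zero]
      exact (hχ.continuous.tendsto 0).comp h2
    simpa using h1.mul_const (f x)
  refine (Lp.eLpNorm_lim_le_liminf_eLpNorm
    (fun n => (hun n).continuous.aestronglyMeasurable) f (Eventually.of_forall hlim)).trans ?_
  refine (liminf_le_liminf (Eventually.of_forall hbound)).trans (le_of_eq (Tendsto.liminf_eq ?_))
  have h0 : Tendsto (fun n => ENNReal.ofReal (ε n * M)) atTop (𝓝 0) := by
    simpa using ENNReal.tendsto_ofReal (hε0.mul_const M)
  have h1 := ENNReal.Tendsto.mul_const h0 (Or.inr hf2.eLpNorm_ne_top)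
  have h2 := h1.const_add (eLpNorm (fderiv ℝ f) 2)
  rw [zero_mul, add_zero] at h2
  exact ENNReal.Tendsto.const_mul h2 (Or.inr ENNReal.coe_ne_top)

lemma eLpNorm_fderiv_le_sum (hf : ContDiff ℝ (⊤ : ℕ∞) f) :
    eLpNorm (fderiv ℝ f) 2 ≤ ∑ l : Fin 3, eLpNorm (pd l f) 2 := by
  have h := eLpNorm_sum_le (p := 2) (μ := volume) (s := Finset.univ)
    (f := fun (l : Fin 3) x => ‖pd l f x‖)
    (fun l _ => hf.pd.continuous.norm.aestronglyMeasurable) (by norm_num)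
  refine (eLpNorm_mono_real fun x => ?_).trans
    (h.trans (Finset.sum_le_sum fun l _ => (eLpNorm_norm _).le))
  simpa using norm_fderiv_le_sum x

lemma exists_eLpNorm_pd_newt_six_le : ∃ K : NNReal, ∀ w : E3 → ℝ, ContDiff ℝ (⊤ : ℕ∞) w →
    HasCompactSupport w → ∀ i : Fin 3, eLpNorm (pd i (newt w)) 6 ≤ K * eLpNorm w 2 := by
  obtain ⟨S, hS⟩ := exists_eLpNorm_six_le
  obtain ⟨K, hK⟩ := exists_eLpNorm_pd_pd_newt_le
  refine ⟨S * (K + K + K), fun w hw hcw i => ?_⟩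
  have hu := (contDiff_newt hw hcw).pd (i := i)
  refine (hS _ hu (memLp_pd_newt hw hcw)).trans ?_
  rw [ENNReal.coe_mul, mul_assoc]
  refine mul_le_mul_right ((eLpNorm_fderiv_le_sum hu).trans ?_) _
  rw [Fin.sum_univ_three, ENNReal.coe_add, ENNReal.coe_add, add_mul, add_mul]
  exact add_le_add (add_le_add (hK w hw hcw 0 i) (hK w hw hcw 1 i)) (hK w hw hcw 2 i)

/-! ### Hölder's inequality with an interpolated factor -/

lemma lintegral_mul_mul_le {a b t : E3 → ℝ} (ha : Continuous a) (hb : Continuous b)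
    (ht : Continuous t) :
    ∫⁻ x, ‖a x * b x * t x‖ₑ
      ≤ eLpNorm a 6 * (eLpNorm b 2 ^ (1 / 2 : ℝ) * eLpNorm b 6 ^ (1 / 2 : ℝ)) * eLpNorm t 2 := by
  have h := ENNReal.lintegral_prod_norm_pow_le (μ := (volume : Measure E3)) Finset.univ
    (f := ![fun x => ‖a x‖ₑ ^ (6 : ℝ), fun x => ‖b x‖ₑ ^ (2 : ℝ), fun x => ‖b x‖ₑ ^ (6 : ℝ),
      fun x => ‖t x‖ₑ ^ (2 : ℝ)])
    (by
      intro l _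
      fin_cases l
      · exact (ha.enorm.measurable.pow_const _).aemeasurable
      · exact (hb.enorm.measurable.pow_const _).aemeasurable
      · exact (hb.enorm.measurable.pow_const _).aemeasurable
      · exact (ht.enorm.measurable.pow_const _).aemeasurable)
    (p := ![1 / 6, 1 / 4, 1 / 12, 1 / 2])
    (by simp [Fin.sum_univ_four]; norm_num)
    (by intro l _; fin_cases l <;> simp)
  simp only [Fin.prod_univ_four, Matrix.cons_val, ← ENNReal.rpow_mul] at h
  have h6 : ∀ u : E3 → ℝ, eLpNorm u 6 = (∫⁻ x, ‖u x‖ₑ ^ (6 : ℝ)) ^ (1 / 6 : ℝ) := fun u => by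
    simpa using eLpNorm_eq_lintegral_rpow_enorm_toReal (μ := volume) (f := u) (p := 6)
      (by simp) (by simp)
  have h2 : ∀ u : E3 → ℝ, eLpNorm u 2 = (∫⁻ x, ‖u x‖ₑ ^ (2 : ℝ)) ^ (1 / 2 : ℝ) := fun u => by
    simpa using eLpNorm_eq_lintegral_rpow_enorm_toReal (μ := volume) (f := u) (p := 2)
      (by simp) (by simp)
  rw [h6, h6, h2, h2, ← ENNReal.rpow_mul, ← ENNReal.rpow_mul]
  convert h using 1
  · refine lintegral_congr fun x => ?_
    rw [enorm_mul, enorm_mul, mul_assoc (‖a x‖ₑ ^ _), ← ENNReal.rpow_add_of_nonneg _ _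
      (by positivity) (by positivity)]
    norm_num
  · norm_num [mul_assoc]

/-! ### Partial derivatives and total derivatives -/

lemma norm_iteratedFDeriv_pd_le (hf : ContDiff ℝ (⊤ : ℕ∞) f) (n : ℕ) (x : E3) :
    ‖iteratedFDeriv ℝ n (pd i f) x‖ ≤ ‖iteratedFDeriv ℝ (n + 1) f x‖ := by
  rw [← norm_iteratedFDeriv_fderiv]
  refine (norm_iteratedFDeriv_clm_apply_const (c := EuclideanSpace.single i (1 : ℝ))
    ((hf.fderiv_right (m := n) (by exact_mod_cast le_top)).contDiffAt) le_rfl).trans ?_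
  simp

lemma norm_pd_pd_le (hf : ContDiff ℝ (⊤ : ℕ∞) f) (x : E3) :
    ‖pd i (pd j f) x‖ ≤ ‖iteratedFDeriv ℝ 2 f x‖ := by
  rw [← norm_iteratedFDeriv_zero (𝕜 := ℝ)]
  exact (norm_iteratedFDeriv_pd_le hf.pd 0 x).trans (norm_iteratedFDeriv_pd_le hf 1 x)

lemma norm_pd_pd_pd_le (hf : ContDiff ℝ (⊤ : ℕ∞) f) (x : E3) :
    ‖pd i (pd j (pd k f)) x‖ ≤ ‖iteratedFDeriv ℝ 3 f x‖ := by
  rw [← norm_iteratedFDeriv_zero (𝕜 := ℝ)]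
  exact (norm_iteratedFDeriv_pd_le hf.pd.pd 0 x).trans
    ((norm_iteratedFDeriv_pd_le hf.pd 1 x).trans (norm_iteratedFDeriv_pd_le hf 2 x))

lemma norm_pd_le_norm_iteratedFDeriv_one (hf : ContDiff ℝ (⊤ : ℕ∞) f) (x : E3) :
    ‖pd i f x‖ ≤ ‖iteratedFDeriv ℝ 1 f x‖ := by
  rw [← norm_iteratedFDeriv_zero (𝕜 := ℝ)]
  exact norm_iteratedFDeriv_pd_le hf 0 x

lemma continuous_iteratedFDeriv_of_contDiff (hf : ContDiff ℝ (⊤ : ℕ∞) f) (n : ℕ) :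
    Continuous (iteratedFDeriv ℝ n f) :=
  hf.continuous_iteratedFDeriv (by exact_mod_cast le_top)

lemma eLpNorm_iteratedFDeriv_eq {n : ℕ} (h : MemLp (iteratedFDeriv ℝ n f) 2) :
    eLpNorm (iteratedFDeriv ℝ n f) 2 = ENNReal.ofReal √(Dsq n f) :=
  eLpNorm_two_eq_ofReal_sqrt h

/-! ### The gradient of the potential -/

lemma memLp_iteratedFDeriv_one_newt (hv : ContDiff ℝ (⊤ : ℕ∞) v) (hcv : HasCompactSupport v) :
    MemLp (iteratedFDeriv ℝ 1 (newt v)) 2 := by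
  have h : MemLp (fun x => ∑ l : Fin 3, ‖pd l (newt v) x‖) 2 :=
    memLp_finsetSum _ fun l _ => (memLp_pd_newt hv hcv).norm
  refine h.mono
    (continuous_iteratedFDeriv_of_contDiff (contDiff_newt hv hcv) 1).aestronglyMeasurable
    (Eventually.of_forall fun x => ?_)
  rw [norm_iteratedFDeriv_one, Real.norm_of_nonneg (Finset.sum_nonneg fun _ _ => norm_nonneg _)]
  exact norm_fderiv_le_sum x

lemma memLp_pd_newt_mul (hv : ContDiff ℝ (⊤ : ℕ∞) v) (hcv : HasCompactSupport v)
    (hg : MemLp g 2) : MemLp (fun x => g x * pd k (newt v) x) 2 := by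
  obtain ⟨M, hM⟩ := exists_abs_newt_pd_le (i := k) hv hcv
  have h := hg.norm.const_mul M
  refine h.mono (hg.aestronglyMeasurable.mul
    (contDiff_newt hv hcv).pd.continuous.aestronglyMeasurable) (Eventually.of_forall fun x => ?_)
  rw [pd_newt hv hcv, norm_mul, norm_mul, norm_norm, mul_comm]
  exact mul_le_mul_of_nonneg_right ((hM x).trans (le_abs_self M)) (norm_nonneg _)

lemma pd_gdot_self (hf : ContDiff ℝ (⊤ : ℕ∞) f) :
    pd j (gdot f f) = fun x => ∑ k : Fin 3, 2 * (pd j (pd k f) x * pd k f x) := by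
  have h : gdot f f = fun x => ∑ k : Fin 3, pd k f x * pd k f x := rfl
  rw [h, pd_sum fun k => hf.pd.mul hf.pd]
  funext x
  refine Finset.sum_congr rfl fun k _ => ?_
  rw [pd_mul hf.pd hf.pd]
  ring

lemma pd_pd_gdot_self (hf : ContDiff ℝ (⊤ : ℕ∞) f) :
    pd i (pd j (gdot f f)) = fun x => ∑ k : Fin 3,
      2 * (pd i (pd j (pd k f)) x * pd k f x + pd i (pd k f) x * pd j (pd k f) x) := by
  rw [pd_gdot_self hf, pd_sum fun k => contDiff_const.mul (hf.pd.pd.mul hf.pd)]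
  funext x
  refine Finset.sum_congr rfl fun k _ => ?_
  rw [pd_mul contDiff_const (hf.pd.pd.mul hf.pd), pd_mul hf.pd.pd hf.pd]
  simp only [pd, fderiv_fun_const, Pi.zero_apply, _root_.zero_apply]
  ring

lemma memLp_pd_gdot_newt (hv : ContDiff ℝ (⊤ : ℕ∞) v) (hcv : HasCompactSupport v) :
    MemLp (pd j (gdot (newt v) (newt v))) 2 := by
  rw [pd_gdot_self (contDiff_newt hv hcv)]
  exact memLp_finsetSum _ fun k _ =>
    (memLp_pd_newt_mul hv hcv (memLp_pd_pd_newt hv hcv)).const_mul 2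

lemma memLp_pd_pd_gdot_newt (hv : ContDiff ℝ (⊤ : ℕ∞) v) (hcv : HasCompactSupport v) :
    MemLp (pd i (pd j (gdot (newt v) (newt v)))) 2 := by
  have h1 : ∀ k, MemLp (fun x => pd i (pd j (pd k (newt v))) x * pd k (newt v) x) 2 := fun k =>
    memLp_pd_newt_mul hv hcv (memLp_pd_pd_pd_newt hv hcv)
  have h2 : ∀ k, MemLp (fun x => pd i (pd k (newt v)) x * pd j (pd k (newt v)) x) 2 := by
    intro k
    rw [pd_newt hv hcv]
    exact memLp_pd_newt_mul hv.pd hcv.pd (memLp_pd_newt hv.pd hcv.pd)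
  rw [pd_pd_gdot_self (contDiff_newt hv hcv)]
  exact memLp_finsetSum _ fun k _ => ((h1 k).add (h2 k)).const_mul 2

lemma memLp_iteratedFDeriv_of_hasCompactSupport (hv : ContDiff ℝ (⊤ : ℕ∞) v)
    (hcv : HasCompactSupport v) (n : ℕ) : MemLp (iteratedFDeriv ℝ n v) 2 :=
  (continuous_iteratedFDeriv_of_contDiff hv n).memLp_of_hasCompactSupport (hcv.iteratedFDeriv n)

/-! ### The trilinear estimate -/

lemma lintegral_le_of_eLpNorm_le {a b t : E3 → ℝ} {A B₁ B₂ T : ℝ} (ha : Continuous a)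
    (hb : Continuous b) (ht : Continuous t) (hA0 : 0 ≤ A) (hB0 : 0 ≤ B₁) (hB0' : 0 ≤ B₂)
    (hA : eLpNorm a 6 ≤ ENNReal.ofReal A) (hB₁ : eLpNorm b 2 ≤ ENNReal.ofReal B₁)
    (hB₂ : eLpNorm b 6 ≤ ENNReal.ofReal B₂) (hT : eLpNorm t 2 ≤ ENNReal.ofReal T) :
    ∫⁻ x, ‖a x * b x * t x‖ₑ ≤ ENNReal.ofReal (A * (√B₁ * √B₂) * T) := by
  refine (lintegral_mul_mul_le ha hb ht).trans ?_
  rw [ENNReal.ofReal_mul (by positivity), ENNReal.ofReal_mul hA0,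
    ENNReal.ofReal_mul (Real.sqrt_nonneg _), Real.sqrt_eq_rpow, Real.sqrt_eq_rpow,
    ← ENNReal.ofReal_rpow_of_nonneg hB0 (by norm_num),
    ← ENNReal.ofReal_rpow_of_nonneg hB0' (by norm_num)]
  exact mul_le_mul' (mul_le_mul' hA (mul_le_mul' (ENNReal.rpow_le_rpow hB₁ (by norm_num))
    (ENNReal.rpow_le_rpow hB₂ (by norm_num)))) hT

lemma exists_lintegral_pd_pd_newt_mul_le : ∃ K : ℝ, 0 ≤ K ∧ ∀ v : E3 → ℝ,
    ContDiff ℝ (⊤ : ℕ∞) v → HasCompactSupport v → ∀ t : E3 → ℝ, Continuous t → ∀ T : ℝ,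
      eLpNorm t 2 ≤ ENNReal.ofReal T → ∀ j k : Fin 3,
      ∫⁻ x, ‖pd j (pd k (newt v)) x * pd k (newt v) x * t x‖ₑ
        ≤ ENNReal.ofReal (K * √√(Dsq 1 (newt v)) * √√(Dsq 0 v) * √(Dsq 1 v) * T) := by
  obtain ⟨K, hK⟩ := exists_eLpNorm_pd_newt_six_le
  refine ⟨K * √K, by positivity, fun v hv hcv t ht T hT j k => ?_⟩
  have hu := contDiff_newt hv hcv
  have hcoe : ∀ r : ℝ, (K : ENNReal) * ENNReal.ofReal r = ENNReal.ofReal (K * r) := fun r => by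
    rw [ENNReal.ofReal_mul K.coe_nonneg, ENNReal.ofReal_coe_nnreal]
  have hA : eLpNorm (pd j (pd k (newt v))) 6 ≤ ENNReal.ofReal (K * √(Dsq 1 v)) := by
    rw [pd_newt hv hcv, ← hcoe,
      ← eLpNorm_iteratedFDeriv_eq (memLp_iteratedFDeriv_of_hasCompactSupport hv hcv 1)]
    exact (hK _ hv.pd hcv.pd j).trans
      (mul_le_mul_right (eLpNorm_mono (norm_pd_le_norm_iteratedFDeriv_one hv)) _)
  have hB₁ : eLpNorm (pd k (newt v)) 2 ≤ ENNReal.ofReal √(Dsq 1 (newt v)) := by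
    rw [← eLpNorm_iteratedFDeriv_eq (memLp_iteratedFDeriv_one_newt hv hcv)]
    exact eLpNorm_mono (norm_pd_le_norm_iteratedFDeriv_one hu)
  have hB₂ : eLpNorm (pd k (newt v)) 6 ≤ ENNReal.ofReal (K * √(Dsq 0 v)) := by
    rw [← hcoe, ← eLpNorm_iteratedFDeriv_eq (memLp_iteratedFDeriv_of_hasCompactSupport hv hcv 0)]
    exact (hK v hv hcv k).trans
      (mul_le_mul_right (eLpNorm_mono fun x => norm_iteratedFDeriv_zero.ge) _)
  refine (lintegral_le_of_eLpNorm_le hu.pd.pd.continuous hu.pd.continuous ht (by positivity)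
    (by positivity) (by positivity) hA hB₁ hB₂ hT).trans (le_of_eq ?_)
  rw [Real.sqrt_mul K.coe_nonneg]
  ring_nf

lemma enorm_integral_pd_gdot_mul_le (hf : ContDiff ℝ (⊤ : ℕ∞) f) {t : E3 → ℝ}
    (ht : Continuous t) :
    ‖∫ x, pd j (gdot f f) x * t x‖ₑ
      ≤ ∑ k : Fin 3, 2 * ∫⁻ x, ‖pd j (pd k f) x * pd k f x * t x‖ₑ := by
  refine (enorm_integral_le_lintegral_enorm _).trans ?_
  have hm : ∀ k : Fin 3, Measurable fun x => ‖pd j (pd k f) x * pd k f x * t x‖ₑ := fun k =>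
    ((hf.pd.pd.continuous.mul hf.pd.continuous).mul ht).enorm.measurable
  simp only [← lintegral_const_mul _ (hm _)]
  rw [← lintegral_finsetSum _ fun k _ => (hm k).const_mul 2]
  refine lintegral_mono fun x => ?_
  rw [pd_gdot_self hf, Finset.sum_mul]
  refine (enorm_sum_le _ _).trans (Finset.sum_le_sum fun k _ => le_of_eq ?_)
  rw [mul_assoc, enorm_mul, Real.enorm_of_nonneg zero_le_two, ENNReal.ofReal_ofNat]

/-- **Second-derivative estimate for `|∇φ|²`.** There is `C > 0` such that for
every smooth compactly supported `v : ℝ³ → ℝ` with Newtonian potential `φ`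
(so `Δφ = v`), every smooth `θ̃ : ℝ³ → ℝ` with derivatives up to order 3 in
`L²(ℝ³)` and decaying at infinity, and all `i, j ∈ {1,2,3}`:
`|⟨∂ᵢ∂ⱼ(|∇φ|²), ∂ᵢ∂ⱼθ̃⟩| ≤ C ‖∇φ‖_{L²} ‖∇²v‖_{L²} ‖∇²θ̃‖_{H¹}
  + C ‖∇φ‖_{L²}^{1/2} ‖v‖_{L²}^{1/2} ‖∇v‖_{L²} ‖∇³θ̃‖_{L²}`. -/
theorem second_derivative_gradsq_estimate :
    ∃ C > (0 : ℝ), ∀ v : E3 → ℝ, ContDiff ℝ (⊤ : ℕ∞) v → HasCompactSupport v →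
      ∀ φ : E3 → ℝ, (∀ x : E3, φ x = newt v x) →
      ∀ θ : E3 → ℝ, ContDiff ℝ (⊤ : ℕ∞) θ →
        (∀ k ≤ 3, Integrable (fun x : E3 => ‖iteratedFDeriv ℝ k θ x‖ ^ 2)) →
        Tendsto θ (cocompact E3) (nhds 0) →
        ∀ i j : Fin 3,
        |∫ x : E3, pd i (pd j (fun y => gdot φ φ y)) x * pd i (pd j θ) x|
          ≤ C * Real.sqrt (Dsq 1 φ) * Real.sqrt (Dsq 2 v)
              * Real.sqrt (Dsq 2 θ + Dsq 3 θ)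
            + C * Real.sqrt (Real.sqrt (Dsq 1 φ)) * Real.sqrt (Real.sqrt (Dsq 0 v))
              * Real.sqrt (Dsq 1 v) * Real.sqrt (Dsq 3 θ) := by
  obtain ⟨K, hK0, hK⟩ := exists_lintegral_pd_pd_newt_mul_le
  refine ⟨6 * K + 1, by positivity, fun v hv hcv φ hφ θ hθ hθ2 _ i j => ?_⟩
  obtain rfl : φ = newt v := funext hφ
  have hu := contDiff_newt hv hcv
  have hg : ContDiff ℝ (⊤ : ℕ∞) (gdot (newt v) (newt v)) :=
    ContDiff.sum fun k _ => hu.pd.mul hu.pd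
  have hθm : ∀ n ≤ 3, MemLp (iteratedFDeriv ℝ n θ) 2 := fun n hn =>
    (memLp_two_iff_integrable_sq_norm
      (continuous_iteratedFDeriv_of_contDiff hθ n).aestronglyMeasurable).2 (hθ2 n hn)
  have hθ₂ : MemLp (pd i (pd j θ)) 2 := (hθm 2 (by norm_num)).mono
    hθ.pd.pd.continuous.aestronglyMeasurable (Eventually.of_forall (norm_pd_pd_le hθ))
  have hθ₃ : MemLp (pd i (pd i (pd j θ))) 2 := (hθm 3 le_rfl).mono
    hθ.pd.pd.pd.continuous.aestronglyMeasurable (Eventually.of_forall (norm_pd_pd_pd_le hθ))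
  have hT : eLpNorm (pd i (pd i (pd j θ))) 2 ≤ ENNReal.ofReal √(Dsq 3 θ) := by
    rw [← eLpNorm_iteratedFDeriv_eq (hθm 3 le_rfl)]
    exact eLpNorm_mono (norm_pd_pd_pd_le hθ)
  have hibp := integral_mul_pd_of_memLp hg.pd hθ.pd.pd (memLp_pd_gdot_newt (j := j) hv hcv)
    (memLp_pd_pd_gdot_newt (i := i) hv hcv) hθ₂ hθ₃
  have hmain := (enorm_integral_pd_gdot_mul_le (j := j) hu hθ.pd.pd.pd.continuous).trans
    (Finset.sum_le_sum fun k _ =>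
      mul_le_mul_right (hK v hv hcv _ hθ.pd.pd.pd.continuous _ hT j k) 2)
  set R := √√(Dsq 1 (newt v)) * √√(Dsq 0 v) * √(Dsq 1 v) * √(Dsq 3 θ) with hR
  have hR0 : 0 ≤ R := by positivity
  have hreal : |∫ x, pd i (pd j (gdot (newt v) (newt v))) x * pd i (pd j θ) x| ≤ 6 * K * R := by
    rw [← abs_neg, ← hibp, ← Real.norm_eq_abs, ← ENNReal.ofReal_le_ofReal_iff (by positivity),
      ofReal_norm]
    refine hmain.trans (le_of_eq ?_)
    rw [Finset.sum_const, Finset.card_univ, Fintype.card_fin, nsmul_eq_mul,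
      ← ENNReal.ofReal_ofNat 2, ← ENNReal.ofReal_mul zero_le_two, ← ENNReal.ofReal_natCast,
      ← ENNReal.ofReal_mul (by positivity)]
    congr 1
    push_cast
    ring
  have h0 : 0 ≤ (6 * K + 1) * √(Dsq 1 (newt v)) * √(Dsq 2 v) * √(Dsq 2 θ + Dsq 3 θ) := by
    positivity
  have h1 : (6 * K + 1) * √√(Dsq 1 (newt v)) * √√(Dsq 0 v) * √(Dsq 1 v) * √(Dsq 3 θ)
      = 6 * K * R + R := by
    rw [hR]
    ring
  rw [h1]
  exact hreal.trans (by linarith)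
end
end
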